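/- arXiv:2505.07221 — 2 statements merged into one kernel-verified Lean document; each statement's English description precedes it below -/
import Mathlib

section
/- Let N and s be positive integers and c=(c_1,…,c_{2s}) a tuple of positive integers. Then Σ over subsets A ⊂ [2s]^{>1}_c containing no pair {2r−1,2r} (r ∈ {1,…,s}) of (−1)^{#A}·N^{−#A}·f_N(c−δ_A) equals Σ over odd-even subsets A ⊂ [2s]^1_c of (−1)^{#A/2}·N^{−#A}·h_N(c_{(−A)}). -/
open scoped Classical

/-- The modified multiple harmonic sum `ζ◇_N(k)` for an index given as a list. -/
noncomputable def zdiaL (N : ℕ) (k : List ℕ) : ℚ :=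
  ∑ A : Finset (Fin k.length),
    if ∀ i ∈ A, k.get i = 1 then
      ∑ n ∈ Finset.univ.filter (fun n : Fin k.length → Fin N =>
        (∀ i, 0 < (n i : ℕ)) ∧
        ∀ (i : Fin k.length) (h : (i : ℕ) + 1 < k.length),
          if i ∈ A then n i ≤ n ⟨(i : ℕ) + 1, h⟩ else n i < n ⟨(i : ℕ) + 1, h⟩),
        ∏ i : Fin k.length,
          if i ∈ A then (1 : ℚ) / ((N : ℚ) - ((n i : ℕ) : ℚ))
          else (1 : ℚ) / (((n i : ℕ) : ℚ) ^ k.get i)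
    else 0

/-- The index `({1}^{c₁-1}, c₂+1, {1}^{c₃-1}, c₄+1, …)` built from an even-length
tuple `c`. -/
def buildIdx : List ℕ → List ℕ
  | [] => []
  | [a] => List.replicate (a - 1) 1
  | a :: b :: rest => (List.replicate (a - 1) 1 ++ [b + 1]) ++ buildIdx rest

/-- `modifyIdx c A B` is the tuple `c_{(-A)} - δ_B`: remove the entries of `c` at the
(0-based) positions in `A`, and subtract `1` from each remaining entry whose original
position lies in `B`. -/
def modifyIdx (c : List ℕ) (A B : Finset ℕ) : List ℕ :=
  ((List.range c.length).filter (fun i => i ∉ A)).map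
    (fun i => c.getD i 0 - (if i ∈ B then 1 else 0))

/-- `f_N(c) = ζ◇_N({1}^{c₁-1}, c₂+1, …, {1}^{c_{2s-1}-1}, c_{2s}+1)`. -/
noncomputable def fN (N : ℕ) (c : List ℕ) : ℚ := zdiaL N (buildIdx c)

/-- The auxiliary sum `h_N(c)`.  Positions are 0-based (0-based position `i`
corresponds to the paper's position `i+1`), so even 0-based positions carry the
`1/(N - n)` factors and odd ones the `1/n` factors; the boundary value `n_{0,c₀}` of
the paper is read as `0`. -/
noncomputable def hN (N : ℕ) (c : List ℕ) : ℚ :=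
  ∑ A : Finset (Fin c.length),
    if ∀ i ∈ A, c.get i = 1 then
      (1 / (N : ℚ)) ^ A.card *
      ∑ n ∈ Finset.univ.filter
        (fun n : ∀ i : Fin c.length, Fin (c.get i) → Fin N =>
          (∀ i, Monotone (n i)) ∧
          (∀ (j : Fin c.length) (b : Fin (c.get j)), (b : ℕ) = 0 →
            if (j : ℕ) = 0 then
              (if j ∈ A then (n j b : ℕ) = 0 else 0 < (n j b : ℕ))
            else
              ∀ (j' : Fin c.length) (a : Fin (c.get j')),
                (j' : ℕ) + 1 = (j : ℕ) → (a : ℕ) + 1 = c.get j' →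
                (if j ∈ A then (n j' a : ℕ) = (n j b : ℕ)
                 else (n j' a : ℕ) < (n j b : ℕ)))),
        ∏ i : Fin c.length, ∏ j : Fin (c.get i),
          if i ∈ A then 1
          else if (i : ℕ) % 2 = 0 then (1 : ℚ) / ((N : ℚ) - ((n i j : ℕ) : ℚ))
          else (1 : ℚ) / ((n i j : ℕ) : ℚ)
    else 0

/-- 0-based translation of the paper's (1-based) *even-odd* condition: a union of
(1-based) pairs `{2r, 2r+1}`. -/
def EvenOddZ (A : Finset ℕ) : Prop :=
  ∀ i ∈ A, (i % 2 = 1 → i + 1 ∈ A) ∧ (i % 2 = 0 → 0 < i ∧ i - 1 ∈ A)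

/-- 0-based translation of the paper's (1-based) *odd-even* condition: a union of
(1-based) pairs `{2r-1, 2r}`. -/
def OddEvenZ (A : Finset ℕ) : Prop :=
  ∀ i ∈ A, (i % 2 = 0 → i + 1 ∈ A) ∧ (i % 2 = 1 → i - 1 ∈ A)

/-- Successor embedding on `ℕ`. -/
def sE : ℕ ↪ ℕ := ⟨Nat.succ, Nat.succ_injective⟩

theorem sum_powerset_emb {α β : Type*} [DecidableEq β] (e : α ↪ β) (b : β) (hb : ∀ a, e a ≠ b)
    (s : Finset α) (F : Finset β → ℚ) :
    ∑ A ∈ (insert b (s.map e)).powerset, F A =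
      ∑ A ∈ s.powerset, (F (A.map e) + F (insert b (A.map e))) := by
  have hb' : b ∉ s.map e := by
    simp only [Finset.mem_map, not_exists, not_and]
    intro a _ h
    exact hb a h
  have hp : (s.map e).powerset = s.powerset.map (Finset.mapEmbedding e).toEmbedding := by
    ext t
    simp only [Finset.mem_powerset, Finset.mem_map, Finset.subset_map_iff]
    constructor
    · rintro ⟨u, hu, rfl⟩
      exact ⟨u, hu, rfl⟩
    · rintro ⟨u, hu, rfl⟩
      exact ⟨u, hu, rfl⟩
  rw [Finset.sum_powerset_insert hb', hp, Finset.sum_map, Finset.sum_map, Finset.sum_add_distrib]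
  rfl

theorem sum_range_powerset_succ (l : ℕ) (F : Finset ℕ → ℚ) :
    ∑ A ∈ (Finset.range (l + 1)).powerset, F A =
      ∑ A ∈ (Finset.range l).powerset, (F (A.map sE) + F (insert 0 (A.map sE))) := by
  rw [← sum_powerset_emb sE 0 (fun a => Nat.succ_ne_zero a), Finset.range_add_one']
  congr!

theorem sum_finset_fin_succ (l : ℕ) (F : Finset (Fin (l + 1)) → ℚ) :
    ∑ A : Finset (Fin (l + 1)), F A =
      ∑ A : Finset (Fin l), (F (A.map (Fin.succEmb l)) + F (insert 0 (A.map (Fin.succEmb l)))) := by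
  have h := sum_powerset_emb (Fin.succEmb l) 0 (fun a => Fin.succ_ne_zero a) Finset.univ F
  rw [Finset.powerset_univ] at h
  rw [← h, ← Finset.powerset_univ]
  congr 2
  ext x
  simp only [Finset.mem_univ, Finset.mem_insert, Finset.mem_map, true_and, true_iff]
  rcases Fin.eq_zero_or_eq_succ x with h | ⟨j, h⟩
  · exact Or.inl h
  · exact Or.inr ⟨j, h.symm⟩

/-- chain condition -/
def Ch {l N : ℕ} (A : Finset (Fin l)) (n : Fin l → Fin N) : Prop :=
  ∀ (i : Fin l) (h : (i : ℕ) + 1 < l),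
    if i ∈ A then n i ≤ n ⟨(i : ℕ) + 1, h⟩ else n i < n ⟨(i : ℕ) + 1, h⟩

/-- `ζ◇` with a general strict lower bound. -/
noncomputable def Zg (N : ℕ) (k : List ℕ) (m : ℕ) : ℚ :=
  ∑ A : Finset (Fin k.length),
    if ∀ i ∈ A, k.get i = 1 then
      ∑ n ∈ Finset.univ.filter (fun n : Fin k.length → Fin N =>
        (∀ i, m < (n i : ℕ)) ∧ Ch A n),
        ∏ i : Fin k.length,
          if i ∈ A then (1 : ℚ) / ((N : ℚ) - ((n i : ℕ) : ℚ))
          else (1 : ℚ) / (((n i : ℕ) : ℚ) ^ k.get i)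
    else 0

theorem zdiaL_eq (N : ℕ) (k : List ℕ) : zdiaL N k = Zg N k 0 := by
  unfold zdiaL Zg Ch
  congr!

theorem Zg_nil (N m : ℕ) : Zg N [] m = 1 := by
  simp [Zg, Ch]

theorem Ch_zero_le {l N : ℕ} {A : Finset (Fin l)} {n : Fin l → Fin N} (h : Ch A n)
    (h0 : 0 < l) : ∀ (i : ℕ) (hi : i < l), n ⟨0, h0⟩ ≤ n ⟨i, hi⟩ := by
  intro i
  induction i with
  | zero => intro _; exact le_rfl
  | succ i ih =>
    intro hi
    refine le_trans (ih (by omega)) ?_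
    have := h ⟨i, by omega⟩ hi
    split_ifs at this
    · exact this
    · exact this.le

theorem Ch_cons {l N : ℕ} (B : Finset (Fin (l+1))) (A : Finset (Fin l))
    (hBA : ∀ i : Fin l, i.succ ∈ B ↔ i ∈ A)
    (x : Fin N) (n : Fin l → Fin N) :
    Ch B (Fin.cons x n : Fin (l+1) → Fin N) ↔
      (∀ i, if (0 : Fin (l+1)) ∈ B then x ≤ n i else x < n i) ∧ Ch A n := by
  constructor
  · intro h
    have hA : Ch A n := by
      intro i hi
      have := h i.succ (by simpa using hi)
      simp only [hBA] at this
      exact this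
    refine ⟨?_, hA⟩
    intro i
    have h0 : 0 < l := i.pos
    have h1 := h 0 (by simpa using h0)
    have h2 := Ch_zero_le hA h0 i i.2
    have h3 : (Fin.cons x n : Fin (l+1) → Fin N) ⟨((0 : Fin (l+1)) : ℕ) + 1, by simpa using h0⟩
      = n ⟨0, h0⟩ := rfl
    rw [h3, Fin.cons_zero] at h1
    split_ifs at h1 ⊢
    · exact h1.trans h2
    · exact h1.trans_le h2
  · rintro ⟨h1, h2⟩ i hi
    rcases Fin.eq_zero_or_eq_succ i with rfl | ⟨j, rfl⟩
    · exact h1 ⟨0, by simpa using hi⟩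
    · have := h2 j (by simpa using hi)
      simp only [hBA]
      exact this

theorem sum_fun_cons {l : ℕ} {σ : Type*} [Fintype σ] (F : (Fin (l+1) → σ) → ℚ) :
    ∑ n, F n = ∑ x, ∑ n : Fin l → σ, F (Fin.cons x n) := by
  rw [← (Fin.consEquiv (fun _ : Fin (l+1) => σ)).sum_comp, Fintype.sum_prod_type]
  rfl

theorem Fin_sum_Ioo (N m : ℕ) (F : ℕ → ℚ) :
    ∑ x : Fin N, (if m < (x:ℕ) then F x else 0) = ∑ n ∈ Finset.Ioo m N, F n := by
  rw [Fin.sum_univ_eq_sum_range (fun x => if m < x then F x else 0) N, ← Finset.sum_filter]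
  congr 1
  ext x
  simp
  tauto

theorem Zg_cons (N k : ℕ) (ks : List ℕ) (m : ℕ) :
    Zg N (k :: ks) m = ∑ n ∈ Finset.Ioo m N, ((1 / (n:ℚ)) ^ k * Zg N ks n +
      if k = 1 then 1 / ((N:ℚ) - n) * Zg N ks (n - 1) else 0) := by
  have key : ∀ (B : Finset (Fin (ks.length + 1))) (A : Finset (Fin ks.length))
    (hBA : ∀ i : Fin ks.length, i.succ ∈ B ↔ i ∈ A),
    (∑ n ∈ Finset.univ.filter (fun n : Fin (ks.length + 1) → Fin N =>
        (∀ i, m < (n i : ℕ)) ∧ Ch B n),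
        ∏ i : Fin (ks.length + 1),
          if i ∈ B then (1 : ℚ) / ((N : ℚ) - ((n i : ℕ) : ℚ))
          else (1 : ℚ) / (((n i : ℕ) : ℚ) ^ (k :: ks).get i)) =
      ∑ x ∈ Finset.Ioo m N, (if 0 ∈ B then (1 : ℚ) / ((N : ℚ) - (x : ℚ))
          else (1 : ℚ) / ((x : ℚ) ^ k)) *
        ∑ n ∈ Finset.univ.filter (fun n : Fin ks.length → Fin N =>
        (∀ i, (if 0 ∈ B then x - 1 else x) < (n i : ℕ)) ∧ Ch A n),
        ∏ i : Fin ks.length,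
          if i ∈ A then (1 : ℚ) / ((N : ℚ) - ((n i : ℕ) : ℚ))
          else (1 : ℚ) / (((n i : ℕ) : ℚ) ^ ks.get i) := by
    intro B A hBA
    rw [← Fin_sum_Ioo, Finset.sum_filter, sum_fun_cons]
    refine Finset.sum_congr rfl fun x _ => ?_
    by_cases hx : m < (x : ℕ)
    · rw [if_pos hx, Finset.mul_sum, Finset.sum_filter]
      refine Finset.sum_congr rfl fun n _ => ?_
      have hc : ((∀ i, m < ((Fin.cons x n : Fin (ks.length+1) → Fin N) i : ℕ)) ∧
          Ch B (Fin.cons x n : Fin (ks.length+1) → Fin N)) ↔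
          ((∀ i, (if 0 ∈ B then (x:ℕ) - 1 else x) < (n i : ℕ)) ∧ Ch A n) := by
        rw [Ch_cons B A hBA, Fin.forall_fin_succ]
        simp only [Fin.cons_zero, Fin.cons_succ, Fin.le_def, Fin.lt_def]
        constructor
        · rintro ⟨⟨_, _⟩, h1, h2⟩
          refine ⟨fun i => ?_, h2⟩
          have := h1 i
          split_ifs at this ⊢ <;> omega
        · rintro ⟨h1, h2⟩
          refine ⟨⟨hx, fun i => ?_⟩, fun i => ?_, h2⟩
          · have := h1 i
            split_ifs at this ⊢ <;> omega
          · have := h1 i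
            split_ifs at this ⊢ <;> omega
      simp only [hc]
      rw [Fin.prod_univ_succ]
      simp [hBA]
    · rw [if_neg hx]
      apply Finset.sum_eq_zero
      intro n _
      rw [if_neg]
      intro h
      exact hx (h.1 0)
  unfold Zg
  refine (sum_finset_fin_succ ks.length _).trans ?_
  simp only [Finset.mul_sum]
  have e1 : ∀ A : Finset (Fin ks.length), (∀ i ∈ A.map (Fin.succEmb ks.length), (k :: ks).get i = 1)
     ↔ (∀ i ∈ A, ks.get i = 1) := by
    intro A
    simp
  have e2 : ∀ A : Finset (Fin ks.length),
    (∀ i ∈ insert 0 (A.map (Fin.succEmb ks.length)), (k :: ks).get i = 1)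
     ↔ (k = 1 ∧ ∀ i ∈ A, ks.get i = 1) := by
    intro A
    simp
  rw [Finset.sum_add_distrib, Finset.sum_add_distrib]
  congr 1
  · rw [Finset.sum_comm]
    refine Finset.sum_congr rfl fun A _ => ?_
    refine (if_congr (e1 A) (key (A.map (Fin.succEmb ks.length)) A (by simp)) rfl).trans ?_
    have h0 : (0 : Fin (ks.length + 1)) ∉ A.map (Fin.succEmb ks.length) := by simp
    simp only [h0, if_false]
    split_ifs with h
    · refine Finset.sum_congr rfl fun x _ => ?_
      rw [one_div_pow]
    · simp
  · by_cases hk : k = 1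
    · simp only [if_pos hk]
      rw [Finset.sum_comm]
      refine Finset.sum_congr rfl fun A _ => ?_
      refine (if_congr (e2 A) (key (insert 0 (A.map (Fin.succEmb ks.length))) A (by simp)) rfl).trans ?_
      have h0 : (0 : Fin (ks.length + 1)) ∈ insert 0 (A.map (Fin.succEmb ks.length)) := by simp
      simp only [h0, if_true, hk, true_and]
      split_ifs with h
      · rfl
      · simp
    · simp only [if_neg hk, Finset.sum_const_zero]
      apply Finset.sum_eq_zero
      intro A _
      rw [if_neg]
      intro h
      exact hk ((e2 A).1 h).1
/-- The condition on summation variables in `h_N`, with a general lower bound. -/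
def Hc {N : ℕ} (c : List ℕ) (A : Finset (Fin c.length)) (m : ℕ)
    (n : ∀ i : Fin c.length, Fin (c.get i) → Fin N) : Prop :=
  (∀ i, Monotone (n i)) ∧
  (∀ (j : Fin c.length) (b : Fin (c.get j)), (b : ℕ) = 0 →
    if (j : ℕ) = 0 then
      (if j ∈ A then (n j b : ℕ) = m else m < (n j b : ℕ))
    else
      ∀ (j' : Fin c.length) (a : Fin (c.get j')),
        (j' : ℕ) + 1 = (j : ℕ) → (a : ℕ) + 1 = c.get j' →
        (if j ∈ A then (n j' a : ℕ) = (n j b : ℕ)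
         else (n j' a : ℕ) < (n j b : ℕ)))

/-- weight by parity -/
noncomputable def wt (N p x : ℕ) : ℚ := if p % 2 = 0 then (1 : ℚ) / ((N : ℚ) - (x : ℚ)) else (1 : ℚ) / (x : ℚ)

/-- `h_N` with general parity and lower bound. -/
noncomputable def Hg (N p : ℕ) (c : List ℕ) (m : ℕ) : ℚ :=
  ∑ A : Finset (Fin c.length),
    if ∀ i ∈ A, c.get i = 1 then
      (1 / (N : ℚ)) ^ A.card *
      ∑ n ∈ Finset.univ.filter
        (fun n : ∀ i : Fin c.length, Fin (c.get i) → Fin N => Hc c A m n),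
        ∏ i : Fin c.length, ∏ j : Fin (c.get i),
          if i ∈ A then 1 else wt N (i + p) (n i j)
    else 0

theorem hN_eq (N : ℕ) (c : List ℕ) : hN N c = Hg N 0 c 0 := by
  unfold hN Hg Hc wt
  simp only [add_zero]
  congr!

theorem Hg_nil (N p m : ℕ) : Hg N p [] m = 1 := by
  have h : (default : Finset (Fin 0)).card = 0 := rfl
  simp [Hg, Hc, h]

theorem sum_dfun_cons {l : ℕ} {σ : Fin (l + 1) → Type} [∀ i, Fintype (σ i)] (F : (∀ i, σ i) → ℚ) :
    ∑ n, F n = ∑ x : σ 0, ∑ n : (∀ i : Fin l, σ i.succ), F (Fin.cons x n) := by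
  rw [← (Fin.consEquiv σ).sum_comp, Fintype.sum_prod_type]
  rfl

theorem Hc_cons {N : ℕ} (a : ℕ) (cs : List ℕ) (B : Finset (Fin (cs.length + 1)))
    (A : Finset (Fin cs.length)) (hBA : ∀ i : Fin cs.length, i.succ ∈ B ↔ i ∈ A) (m : ℕ)
    (x : Fin (a + 1) → Fin N) (n : ∀ i : Fin cs.length, Fin (cs.get i) → Fin N) :
    Hc ((a + 1) :: cs) B m (Fin.cons x n : ∀ i : Fin (cs.length + 1), Fin (((a + 1) :: cs).get i) → Fin N) ↔
      (Monotone x ∧ (if (0 : Fin (cs.length + 1)) ∈ B then (x 0 : ℕ) = m else m < (x 0 : ℕ))) ∧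
        Hc cs A (x (Fin.last a)) n := by
  constructor
  · rintro ⟨h1, h2⟩
    refine ⟨⟨h1 0, ?_⟩, fun i => h1 i.succ, ?_⟩
    · have := h2 0 (0 : Fin (a + 1)) rfl
      exact this
    · intro j b hb
      have := h2 j.succ b hb
      split_ifs with h0
      · have h3 := this (0 : Fin (cs.length + 1)) (Fin.last a) (by simp [h0]) (by simp)
        rw [if_pos ((hBA j).2 ‹_›)] at h3
        exact h3.symm
      · have h3 := this (0 : Fin (cs.length + 1)) (Fin.last a) (by simp [h0]) (by simp)
        rw [if_neg (fun h => ‹j ∉ A› ((hBA j).1 h))] at h3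
        exact h3
      · intro j' a' h4 h5
        have h3 := this j'.succ a' (by simp [h4]) h5
        rw [if_pos ((hBA j).2 ‹_›)] at h3
        exact h3
      · intro j' a' h4 h5
        have h3 := this j'.succ a' (by simp [h4]) h5
        rw [if_neg (fun h => ‹j ∉ A› ((hBA j).1 h))] at h3
        exact h3
  · rintro ⟨⟨h1, h2⟩, h3, h4⟩
    refine ⟨?_, ?_⟩
    · intro i
      rcases Fin.eq_zero_or_eq_succ i with rfl | ⟨j, rfl⟩
      · exact h1
      · exact h3 j
    · intro i b hb
      rcases Fin.eq_zero_or_eq_succ i with rfl | ⟨j, rfl⟩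
      · have hb0 : b = (0 : Fin (a + 1)) := Fin.ext hb
        subst hb0
        exact h2
      · have h5 := h4 j b hb
        refine (if_neg (Nat.succ_ne_zero j)).mpr ?_
        intro j' a' h6 h7
        rcases Fin.eq_zero_or_eq_succ j' with rfl | ⟨k, rfl⟩
        · have hj : (j : ℕ) = 0 := by simpa using h6.symm
          have ha : a' = Fin.last a := Fin.ext (Nat.succ_injective h7)
          subst ha
          rw [if_pos hj] at h5
          by_cases hA : j ∈ A
          · rw [if_pos hA] at h5
            exact (if_pos ((hBA j).2 hA)).mpr h5.symm
          · rw [if_neg hA] at h5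
            exact (if_neg (fun h => hA ((hBA j).1 h))).mpr h5
        · have hk : (k : ℕ) + 1 = j := by simpa using h6
          rw [if_neg (by omega)] at h5
          have h8 := h5 k a' hk h7
          by_cases hA : j ∈ A
          · rw [if_pos hA] at h8
            exact (if_pos ((hBA j).2 hA)).mpr h8
          · rw [if_neg hA] at h8
            exact (if_neg (fun h => hA ((hBA j).1 h))).mpr h8

theorem Hg_cons (N p a : ℕ) (cs : List ℕ) (m : ℕ) :
    Hg N p ((a + 1) :: cs) m = ∑ x : Fin (a + 1) → Fin N,
      ((if Monotone x ∧ m < (x 0 : ℕ) then (∏ j, wt N p (x j)) * Hg N (p + 1) cs (x (Fin.last a)) else 0)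
      + if a = 0 ∧ Monotone x ∧ (x 0 : ℕ) = m then (1 / (N : ℚ)) * Hg N (p + 1) cs (x (Fin.last a)) else 0) := by
  have key : ∀ (B : Finset (Fin (cs.length + 1))) (A : Finset (Fin cs.length))
    (_ : ∀ i : Fin cs.length, i.succ ∈ B ↔ i ∈ A),
    (∑ n ∈ Finset.univ.filter
        (fun n : ∀ i : Fin (cs.length + 1), Fin (((a + 1) :: cs).get i) → Fin N => Hc ((a + 1) :: cs) B m n),
        ∏ i : Fin (cs.length + 1), ∏ j : Fin (((a + 1) :: cs).get i),
          if i ∈ B then 1 else wt N (i + p) (n i j)) =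
      ∑ x : Fin (a + 1) → Fin N,
        if (Monotone x ∧ (if (0 : Fin (cs.length + 1)) ∈ B then (x 0 : ℕ) = m else m < (x 0 : ℕ))) then
          (if (0 : Fin (cs.length + 1)) ∈ B then 1 else ∏ j, wt N p (x j)) *
          ∑ n ∈ Finset.univ.filter
            (fun n : ∀ i : Fin cs.length, Fin (cs.get i) → Fin N => Hc cs A (x (Fin.last a)) n),
            ∏ i : Fin cs.length, ∏ j : Fin (cs.get i),
              if i ∈ A then 1 else wt N (i + (p + 1)) (n i j)
        else 0 := by
    intro B A hBA
    rw [Finset.sum_filter]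
    refine (sum_dfun_cons _).trans ?_
    refine Finset.sum_congr rfl fun (x : Fin (a + 1) → Fin N) _ => ?_
    by_cases hx : (Monotone x ∧ (if (0 : Fin (cs.length + 1)) ∈ B then (x 0 : ℕ) = m else m < (x 0 : ℕ)))
    · rw [if_pos hx, Finset.sum_filter, Finset.mul_sum]
      refine Finset.sum_congr rfl fun n _ => ?_
      have hc := Hc_cons a cs B A hBA m x n
      by_cases hA : Hc cs A (x (Fin.last a)) n
      · rw [if_pos (hc.2 ⟨hx, hA⟩), if_pos hA, Fin.prod_univ_succ]
        congr 1
        · by_cases h0 : (0 : Fin (cs.length + 1)) ∈ B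
          · simp only [h0, if_true, Finset.prod_const_one]
          · simp only [h0, if_false]
            refine Finset.prod_congr rfl fun j _ => ?_
            simp only [Fin.val_zero, zero_add]
            rfl
        · refine Finset.prod_congr rfl fun i _ => ?_
          refine Finset.prod_congr rfl fun j _ => ?_
          simp only [hBA, Fin.val_succ]
          rw [add_right_comm, add_assoc]
          rfl
      · rw [if_neg (fun h => hA (hc.1 h).2), if_neg hA, mul_zero]
    · rw [if_neg hx]
      apply Finset.sum_eq_zero
      intro n _
      rw [if_neg]
      intro h
      exact hx ((Hc_cons a cs B A hBA m x n).1 h).1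
  unfold Hg
  refine (sum_finset_fin_succ cs.length _).trans ?_
  have e1 : ∀ A : Finset (Fin cs.length), (∀ i ∈ A.map (Fin.succEmb cs.length), ((a + 1) :: cs).get i = 1)
     ↔ (∀ i ∈ A, cs.get i = 1) := by
    intro A
    simp
  have e2 : ∀ A : Finset (Fin cs.length),
    (∀ i ∈ insert 0 (A.map (Fin.succEmb cs.length)), ((a + 1) :: cs).get i = 1)
     ↔ (a = 0 ∧ ∀ i ∈ A, cs.get i = 1) := by
    intro A
    simp
  rw [Finset.sum_add_distrib, Finset.sum_add_distrib]
  congr 1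
  · simp only [Finset.mul_sum (s := (Finset.univ : Finset (Finset _)))]
    have hr : ∀ x : Fin (a + 1) → Fin N, ∀ F : Finset (Fin cs.length) → ℚ,
      (if Monotone x ∧ m < (x 0 : ℕ) then ∑ A, F A else 0) =
        ∑ A, if Monotone x ∧ m < (x 0 : ℕ) then F A else 0 := by
      intro x F
      split_ifs <;> simp
    simp only [hr]
    rw [Finset.sum_comm]
    refine Finset.sum_congr rfl fun A _ => ?_
    refine (if_congr (e1 A) (congrArg _ (key (A.map (Fin.succEmb cs.length)) A (by simp))) rfl).trans ?_
    have h0 : (0 : Fin (cs.length + 1)) ∉ A.map (Fin.succEmb cs.length) := by simp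
    simp only [h0, if_false, Finset.card_map]
    split_ifs with h
    · rw [Finset.mul_sum]
      refine Finset.sum_congr rfl fun x _ => ?_
      split_ifs
      · ring
      · ring
    · simp
  · by_cases hk : a = 0
    · simp only [hk, true_and]
      simp only [Finset.mul_sum (s := (Finset.univ : Finset (Finset _)))]
      have hr : ∀ x : Fin (a + 1) → Fin N, ∀ F : Finset (Fin cs.length) → ℚ,
        (if Monotone x ∧ (x 0 : ℕ) = m then ∑ A, F A else 0) =
          ∑ A, if Monotone x ∧ (x 0 : ℕ) = m then F A else 0 := by
        intro x F
        split_ifs <;> simp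
      subst hk
      simp only [hr]
      rw [Finset.sum_comm]
      refine Finset.sum_congr rfl fun A _ => ?_
      refine (if_congr (e2 A) (congrArg _ (key (insert 0 (A.map (Fin.succEmb cs.length))) A (by simp))) rfl).trans ?_
      have h0 : (0 : Fin (cs.length + 1)) ∈ insert 0 (A.map (Fin.succEmb cs.length)) := by simp
      have h1 : (0 : Fin (cs.length + 1)) ∉ A.map (Fin.succEmb cs.length) := by simp
      simp only [h0, if_true, true_and]
      rw [Finset.card_insert_of_notMem h1, Finset.card_map]
      split_ifs with h
      · rw [Finset.mul_sum]
        refine Finset.sum_congr rfl fun x _ => ?_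
        split_ifs
        · ring
        · ring
      · simp
    · simp only [hk, false_and, if_false, Finset.sum_const_zero]
      apply Finset.sum_eq_zero
      intro A _
      rw [if_neg]
      intro h
      exact hk ((e2 A).1 h).1
theorem sum_Ioo_step (n N : ℕ) (h : n + 1 < N) (f : ℕ → ℚ) :
    ∑ x ∈ Finset.Ioo n N, f x = f (n + 1) + ∑ x ∈ Finset.Ioo (n + 1) N, f x := by
  have : Finset.Ioo n N = insert (n + 1) (Finset.Ioo (n + 1) N) := by
    ext x
    simp only [Finset.mem_Ioo, Finset.mem_insert]
    omega
  rw [this, Finset.sum_insert (by simp)]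

/-- Operators on functions `ℕ → ℚ`. -/
abbrev Op := Module.End ℚ (ℕ → ℚ)

/-- Diagonal operator supported on `1 ≤ n < N`. -/
def Dg (N : ℕ) (w : ℕ → ℚ) : Op where
  toFun φ := fun n => if 0 < n ∧ n < N then w n * φ n else 0
  map_add' φ ψ := by
    ext n
    simp only [Pi.add_apply]
    split_ifs <;> ring
  map_smul' r φ := by
    ext n
    simp only [Pi.smul_apply, smul_eq_mul, RingHom.id_apply]
    split_ifs <;> ring

/-- Strict summation. -/
def Ts (N : ℕ) : Op where
  toFun φ := fun m => ∑ n ∈ Finset.Ioo m N, φ n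
  map_add' φ ψ := by
    ext n
    simp [Finset.sum_add_distrib]
  map_smul' r φ := by
    ext n
    simp [Finset.mul_sum]

/-- The connector. -/
def cK (N n m : ℕ) : ℚ :=
  if n = 0 then (if m = 0 then 1 else 0) else if m = 0 then 0 else
    ((m - 1).choose (n - 1) : ℚ) / ((N - 1).choose n : ℚ)

/-- The connecting operator. -/
def Kc (N : ℕ) : Op where
  toFun φ := fun n => ∑ m ∈ Finset.range N, cK N n m * φ m
  map_add' φ ψ := by
    ext n
    simp [Finset.sum_add_distrib, mul_add]
  map_smul' r φ := by
    ext n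
    simp [Finset.mul_sum, mul_left_comm]

theorem Dg_apply (N : ℕ) (w φ : ℕ → ℚ) (n : ℕ) :
    Dg N w φ n = if 0 < n ∧ n < N then w n * φ n else 0 := rfl
theorem Ts_apply (N : ℕ) (φ : ℕ → ℚ) (m : ℕ) :
    Ts N φ m = ∑ n ∈ Finset.Ioo m N, φ n := rfl
theorem Kc_apply (N : ℕ) (φ : ℕ → ℚ) (n : ℕ) :
    Kc N φ n = ∑ m ∈ Finset.range N, cK N n m * φ m := rfl

/-- weight functions -/
abbrev wx : ℕ → ℚ := fun n => 1 / (n : ℚ)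
/-- weight functions -/
abbrev wy (N : ℕ) : ℕ → ℚ := fun n => 1 / ((N : ℚ) - n)
/-- The operator `x`. -/
abbrev Xo (N : ℕ) : Op := Dg N wx
/-- The operator `y`. -/
abbrev Yo (N : ℕ) : Op := Dg N (wy N)
/-- The projection. -/
abbrev Po (N : ℕ) : Op := Dg N 1
/-- The inverse of `x`. -/
abbrev Xi (N : ℕ) : Op := Dg N (fun n => (n : ℚ))
/-- The inverse of `y`. -/
abbrev Yi (N : ℕ) : Op := Dg N (fun n => (N : ℚ) - n)

theorem Dg_mul (N : ℕ) (w v : ℕ → ℚ) : Dg N w * Dg N v = Dg N (w * v) := by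
  ext φ n
  simp only [Module.End.mul_apply, Dg_apply, Pi.mul_apply]
  split_ifs <;> ring

theorem Dg_congr (N : ℕ) (w v : ℕ → ℚ) (h : ∀ n, 0 < n → n < N → w n = v n) :
    Dg N w = Dg N v := by
  ext φ n
  simp only [Dg_apply]
  split_ifs with h'
  · rw [h n h'.1 h'.2]
  · rfl

theorem Dg_Po (N : ℕ) (w : ℕ → ℚ) : Dg N w * Po N = Dg N w := by
  rw [Dg_mul, mul_one]
theorem Po_Dg (N : ℕ) (w : ℕ → ℚ) : Po N * Dg N w = Dg N w := by
  rw [Dg_mul, one_mul]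
theorem Dg_comm (N : ℕ) (w v : ℕ → ℚ) : Dg N w * Dg N v = Dg N v * Dg N w := by
  rw [Dg_mul, Dg_mul, mul_comm]

theorem Xo_Xi (N : ℕ) : Xo N * Xi N = Po N := by
  rw [Dg_mul]
  apply Dg_congr
  intro n h _
  have : (n : ℚ) ≠ 0 := by positivity
  simp [this]

theorem sub_ne (N n : ℕ) (h : n < N) : (N : ℚ) - n ≠ 0 := by
  have : (n : ℚ) < N := by exact_mod_cast h
  linarith

theorem Yo_Yi (N : ℕ) : Yo N * Yi N = Po N := by
  rw [Dg_mul]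
  apply Dg_congr
  intro n _ h
  have := sub_ne N n h
  simp [this]

theorem XY (N : ℕ) : (N : ℚ) • (Xo N * Yo N) = Xo N + Yo N := by
  rw [Dg_mul]
  ext φ n
  simp only [LinearMap.smul_apply, LinearMap.add_apply, Dg_apply, Pi.smul_apply, Pi.add_apply,
    Pi.mul_apply, smul_eq_mul]
  split_ifs with h
  · have := sub_ne N n h.2
    have : (n : ℚ) ≠ 0 := by have := h.1; positivity
    field_simp
    ring
  · simp

theorem Yi_eq (N : ℕ) : Yi N = (N : ℚ) • Po N - Xi N := by
  ext φ n
  simp only [LinearMap.smul_apply, LinearMap.sub_apply, Dg_apply, Pi.smul_apply, Pi.sub_apply,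
    smul_eq_mul, Pi.one_apply]
  split_ifs with h <;> ring

theorem Ts_Po (N : ℕ) : Ts N * Po N = Ts N := by
  ext φ m
  simp only [Module.End.mul_apply, Ts_apply, Dg_apply]
  refine Finset.sum_congr rfl fun n hn => ?_
  rw [Finset.mem_Ioo] at hn
  rw [if_pos ⟨by omega, hn.2⟩]
  simp

theorem Po_K (N : ℕ) : Po N * Kc N * Po N = Po N * Kc N := by
  ext φ n
  simp only [Module.End.mul_apply, Kc_apply, Dg_apply]
  split_ifs with h
  · congr 1
    refine Finset.sum_congr rfl fun m hm => ?_
    rw [Finset.mem_range] at hm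
    by_cases h0 : 0 < m
    · rw [if_pos ⟨h0, hm⟩]
      simp
    · have : n ≠ 0 := by omega
      have h1 : m = 0 := by omega
      simp [cK, this, h1]
  · rfl

theorem sum_swap (N : ℕ) (c g : ℕ → ℚ) :
    ∑ j ∈ Finset.range N, c j * ∑ m ∈ Finset.Ioo j N, g m =
      ∑ m ∈ Finset.range N, (∑ j ∈ Finset.range m, c j) * g m := by
  simp only [Finset.mul_sum, Finset.sum_mul]
  refine Finset.sum_comm' ?_
  intro x y
  simp only [Finset.mem_range, Finset.mem_Ioo]
  omega

theorem cum_cK (N n m : ℕ) :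
    ∑ j ∈ Finset.range (m + 1), cK N n j = (m.choose n : ℚ) / ((N - 1).choose n : ℚ) := by
  induction m with
  | zero =>
    rcases n with _ | n
    · simp [cK]
    · simp [cK]
  | succ m ih =>
    rw [Finset.sum_range_succ, ih]
    rcases n with _ | n
    · simp [cK]
    · simp only [cK, Nat.add_eq_zero_iff, one_ne_zero, and_false, if_false, Nat.add_sub_cancel]
      rw [Nat.choose_succ_succ m n]
      push_cast
      ring

theorem XK (N : ℕ) : Xo N * Kc N = Po N * Kc N * ((1 + Ts N) * Xo N) := by
  ext φ n
  simp only [Module.End.mul_apply, LinearMap.add_apply, Module.End.one_apply, Kc_apply,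
    Dg_apply (n := n), Pi.add_apply, Ts_apply, Pi.one_apply]
  split_ifs with h
  · simp only [mul_add, Finset.sum_add_distrib, one_mul]
    rw [sum_swap, ← Finset.sum_add_distrib, Finset.mul_sum]
    refine Finset.sum_congr rfl fun m hm => ?_
    rw [Finset.mem_range] at hm
    rw [← add_mul, add_comm (cK N n m), ← Finset.sum_range_succ, cum_cK, Dg_apply]
    obtain ⟨n, rfl⟩ : ∃ k, n = k + 1 := ⟨n - 1, by omega⟩
    rcases m with _ | m
    · simp [cK]
    · rw [if_pos ⟨by omega, hm⟩]
      simp only [cK, Nat.add_eq_zero_iff, one_ne_zero, and_false, if_false, Nat.add_sub_cancel]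
      have h1 : ((m + 1 : ℕ) : ℚ) * (m.choose n) = ((m+1).choose (n+1)) * ((n + 1 : ℕ) : ℚ) := by
        exact_mod_cast Nat.add_one_mul_choose_eq m n
      have h2 : ((m + 1 : ℕ) : ℚ) ≠ 0 := by positivity
      have h3 : ((n + 1 : ℕ) : ℚ) ≠ 0 := by positivity
      have h4 : ((m+1).choose (n+1) : ℚ) = ((m + 1 : ℕ) : ℚ) * (m.choose n) / ((n + 1 : ℕ) : ℚ) := by
        rw [h1]; field_simp
      rw [h4]
      field_simp
  · rfl

theorem entry (M k q : ℕ) (hk : k < M) (hq : q < M) :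
    1 / ((k + 1 : ℕ) : ℚ) * ((q.choose k : ℚ) / (M.choose (k + 1) : ℚ)) =
      ((q.choose k : ℚ) / (M.choose k) - (q.choose (k + 1) : ℚ) / (M.choose (k + 1))) / ((M : ℚ) - q) := by
  have hA : (M.choose k : ℚ) ≠ 0 := by exact_mod_cast (Nat.choose_pos hk.le).ne'
  have h1 : (M.choose (k + 1) : ℚ) = M.choose k * ((M : ℚ) - k) / ((k + 1 : ℕ) : ℚ) := by
    have h2 : ((k + 1 : ℕ) : ℚ) ≠ 0 := by positivity
    rw [eq_div_iff h2, ← Nat.cast_sub hk.le]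
    exact_mod_cast Nat.choose_succ_right_eq M k
  have h3 : (q.choose (k + 1) : ℚ) = q.choose k * ((q : ℚ) - k) / ((k + 1 : ℕ) : ℚ) := by
    have h2 : ((k + 1 : ℕ) : ℚ) ≠ 0 := by positivity
    rw [eq_div_iff h2]
    by_cases hkq : k ≤ q
    · rw [← Nat.cast_sub hkq]
      exact_mod_cast Nat.choose_succ_right_eq q k
    · rw [Nat.choose_eq_zero_of_lt (by omega : q < k), Nat.choose_eq_zero_of_lt (by omega : q < k+1)]
      simp
  have h4 := sub_ne M k hk
  have h5 := sub_ne M q hq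
  have h2 : ((k + 1 : ℕ) : ℚ) ≠ 0 := by positivity
  rw [h1, h3]
  field_simp
  ring

theorem tele (N q : ℕ) (hq : q + 1 < N) (d : ℕ) : ∀ n, N - n = d →
    ∑ k ∈ Finset.Ioo n N, 1 / (k : ℚ) * cK N k (q + 1) =
      (q.choose n : ℚ) / ((N - 1).choose n : ℚ) / ((N : ℚ) - (q + 1 : ℕ)) := by
  induction d with
  | zero =>
    intro n hn
    rw [Finset.Ioo_eq_empty_of_le (by omega), Nat.choose_eq_zero_of_lt (by omega : q < n)]
    simp
  | succ d ih =>
    intro n hn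
    by_cases h : n + 1 < N
    · rw [sum_Ioo_step n N h, ih (n + 1) (by omega)]
      obtain ⟨M, rfl⟩ : ∃ M, N = M + 1 := ⟨N - 1, by omega⟩
      have := entry M n q (by omega) (by omega)
      simp only [cK, Nat.add_eq_zero_iff, one_ne_zero, and_false, if_false, Nat.add_sub_cancel]
      rw [this]
      push_cast
      rw [add_sub_add_right_eq_sub]
      ring
    · have : Finset.Ioo n N = ∅ := by
        ext x
        simp
        omega
      rw [this, Nat.choose_eq_zero_of_lt (by omega : q < n)]
      simp

theorem TXK (N : ℕ) : Ts N * Xo N * Kc N = Kc N * Ts N * Yo N := by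
  ext φ n
  simp only [Module.End.mul_apply, Kc_apply (n := n), Ts_apply]
  rw [sum_swap]
  have : ∀ k ∈ Finset.Ioo n N, Xo N (Kc N φ) k =
      ∑ m ∈ Finset.range N, 1 / (k : ℚ) * cK N k m * φ m := by
    intro k hk
    rw [Finset.mem_Ioo] at hk
    rw [Dg_apply, if_pos ⟨by omega, hk.2⟩, Kc_apply, Finset.mul_sum]
    refine Finset.sum_congr rfl fun m _ => ?_
    ring
  rw [Finset.sum_congr rfl this, Finset.sum_comm]
  refine Finset.sum_congr rfl fun m hm => ?_
  rw [Finset.mem_range] at hm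
  rw [← Finset.sum_mul, Dg_apply]
  rcases m with _ | m
  · simp only [lt_irrefl, false_and, if_false, mul_zero]
    rw [Finset.sum_eq_zero, zero_mul]
    intro k hk
    rw [Finset.mem_Ioo] at hk
    have : k ≠ 0 := by omega
    simp [cK, this]
  · rw [if_pos ⟨by omega, hm⟩, tele N m hm _ n rfl, cum_cK]
    ring

theorem K_zero (N : ℕ) (hN : 0 < N) (φ : ℕ → ℚ) : Kc N φ 0 = φ 0 := by
  rw [Kc_apply, Finset.sum_eq_single_of_mem 0 (by simpa using hN)]
  · simp [cK]
  · intro b _ hb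
    simp [cK, hb]

theorem K_one (N n : ℕ) (hn : n < N) : Kc N 1 n = 1 := by
  rw [Kc_apply]
  simp only [Pi.one_apply, mul_one]
  obtain ⟨M, rfl⟩ : ∃ M, N = M + 1 := ⟨N - 1, by omega⟩
  rw [cum_cK, Nat.add_sub_cancel, div_self]
  exact_mod_cast (Nat.choose_pos (by omega)).ne.symm
/-- Nonstrict summation. -/
abbrev So (N : ℕ) : Op := 1 + Ts N
/-- Operator `U`. -/
abbrev Uo (N : ℕ) : Op := (N : ℚ) • (Xo N * Ts N) + 1
/-- Operator `P_a`. -/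
def Pa (N a : ℕ) : Op := Ts N * (Yo N * Uo N) ^ a * Xo N
/-- Operator `Q_a`. -/
def Qa (N a : ℕ) : Op := Ts N * Yo N * (So N * Yo N) ^ a

theorem alg_step {R : Type*} [Ring R] [Algebra ℚ R] (T X Y P Xi Yi K : R) (N : ℚ)
    (hXP : X * P = X) (hPY : P * Y = Y) (hYX : Y * X = X * Y)
    (hXXi : X * Xi = P) (hYYi : Y * Yi = P) (hYiY : Yi * Y = P) (hYi : Yi = N • P - Xi)
    (hPK : P * K * P = P * K) (hXK : X * K = P * K * ((1 + T) * X))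
    (hTXK : T * X * K = K * T * Y) :
    (Y * (N • (X * T) + 1)) * (X * K) = X * K * ((1 + T) * Y) := by
  have e1 : (Y * (N • (X * T) + 1)) * (X * K) = N • (X * Y * K * T * Y) + X * Y * K := by
    calc (Y * (N • (X * T) + 1)) * (X * K) = N • (Y * X * (T * X * K)) + Y * X * K := by
          simp only [mul_add, add_mul, mul_smul_comm, smul_mul_assoc, mul_one, mul_assoc]
      _ = _ := by rw [hTXK, hYX]; simp only [mul_assoc]
  have e3 : P * K * ((1 + T) * Y) = X * K * Xi * Y := by
    calc P * K * ((1 + T) * Y) = P * K * ((1 + T) * (P * Y)) := by rw [hPY]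
      _ = (P * K * ((1 + T) * X)) * Xi * Y := by rw [← hXXi]; simp only [mul_assoc]
      _ = _ := by rw [← hXK]
  have e4 : X * K * ((1 + T) * Y) = N • (X * Y * K * ((1 + T) * Y)) - X * Y * K * Xi * Y := by
    calc X * K * ((1 + T) * Y) = X * (Y * Yi) * K * ((1 + T) * Y) := by rw [hYYi, hXP]
      _ = N • (X * Y * P * K * ((1 + T) * Y)) - Y * (X * Xi) * K * ((1 + T) * Y) := by
          rw [hYi]
          have : Y * (X * Xi) = X * Y * Xi := by rw [← mul_assoc, hYX]
          rw [this]
          simp only [mul_sub, sub_mul, mul_smul_comm, smul_mul_assoc, mul_assoc]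
      _ = N • (X * Y * K * ((1 + T) * Y)) - Y * (P * K * ((1 + T) * Y)) := by
          rw [hXXi]
          have : X * Y * P = X * Y := by rw [← hYX, mul_assoc, hXP]
          rw [this]
          simp only [mul_assoc]
      _ = _ := by
          rw [e3, ← hYX]; simp only [mul_assoc]
  have e5 : X * Y * K = N • (X * Y * K * Y) - X * Y * K * Xi * Y := by
    have h1 : X * Y * K = X * Y * K * P := by
      calc X * Y * K = Y * X * K := by rw [hYX]
        _ = Y * X * (P * K) := by rw [← mul_assoc, mul_assoc Y X P, hXP]
        _ = Y * X * (P * K * P) := by rw [hPK]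
        _ = Y * (X * P) * K * P := by simp only [mul_assoc]
        _ = _ := by rw [hXP, hYX]
    calc X * Y * K = X * Y * K * (Yi * Y) := by rw [hYiY, ← h1]
      _ = N • (X * Y * K * (P * Y)) - X * Y * K * Xi * Y := by
          rw [hYi]
          simp only [mul_sub, sub_mul, mul_smul_comm, smul_mul_assoc, mul_assoc]
      _ = _ := by rw [hPY]
  rw [e1, e4]
  nth_rewrite 2 [e5]
  simp only [mul_add, add_mul, one_mul, smul_add, mul_assoc]
  abel

theorem op_step (N : ℕ) : (Yo N * Uo N) * (Xo N * Kc N) = Xo N * Kc N * (So N * Yo N) :=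
  alg_step (Ts N) (Xo N) (Yo N) (Po N) (Xi N) (Yi N) (Kc N) N
    (Dg_Po N _) (Po_Dg N _) (Dg_comm N _ _) (Xo_Xi N) (Yo_Yi N)
    (by rw [Dg_comm, Yo_Yi]) (Yi_eq N) (Po_K N) (XK N) (TXK N)

theorem Pa_K (N a : ℕ) : Pa N a * Kc N = Kc N * Qa N a := by
  unfold Pa Qa
  induction a with
  | zero => simpa [mul_assoc] using TXK N
  | succ a ih =>
    calc Ts N * (Yo N * Uo N) ^ (a + 1) * Xo N * Kc N
        = Ts N * (Yo N * Uo N) ^ a * ((Yo N * Uo N) * (Xo N * Kc N)) := by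
          rw [pow_succ]; simp only [mul_assoc]
      _ = (Ts N * (Yo N * Uo N) ^ a * Xo N * Kc N) * (So N * Yo N) := by
          rw [op_step]; simp only [mul_assoc]
      _ = _ := by rw [ih, pow_succ]; simp only [mul_assoc]

theorem Pa_X_K (N a b : ℕ) : Pa N a * Xo N ^ b * Kc N = Kc N * (Qa N a * (So N * Xo N) ^ b) := by
  induction b with
  | zero => simpa using Pa_K N a
  | succ b ih =>
    have h : Pa N a * Xo N ^ b * Po N = Pa N a * Xo N ^ b := by
      rcases b with _ | b
      · simp only [pow_zero, mul_one, Pa, mul_assoc, Dg_Po]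
      · rw [pow_succ]
        simp only [mul_assoc, Dg_Po]
    calc Pa N a * Xo N ^ (b + 1) * Kc N = Pa N a * Xo N ^ b * (Xo N * Kc N) := by
          rw [pow_succ]; simp only [mul_assoc]
      _ = (Pa N a * Xo N ^ b * Po N) * Kc N * (So N * Xo N) := by
          rw [XK]; simp only [mul_assoc]
      _ = _ := by rw [h, ih, pow_succ]; simp only [mul_assoc]

/-- left block -/
noncomputable def Lb (N a b : ℕ) : Op :=
  Pa N a * Xo N ^ (b + 1) - (if a = 0 then 0 else (1 / (N : ℚ)) • (Pa N (a - 1) * Xo N ^ (b + 1)))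
    - (if b = 0 then 0 else (1 / (N : ℚ)) • (Pa N a * Xo N ^ b))

/-- right block -/
noncomputable def Rb (N a b : ℕ) : Op :=
  (Qa N a + if a = 0 then (1 / (N : ℚ)) • 1 else 0) *
    (Ts N * Xo N * (So N * Xo N) ^ b + if b = 0 then (1 / (N : ℚ)) • 1 else 0)
    - if a = 0 ∧ b = 0 then (1 / (N : ℚ)) ^ 2 • 1 else 0

theorem XY' (N : ℕ) (hN : 0 < N) : Yo N * Xo N = (1 / (N : ℚ)) • Xo N + (1 / (N : ℚ)) • Yo N := by
  rw [← smul_add, ← XY, smul_smul, Dg_comm]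
  have : (N : ℚ) ≠ 0 := by positivity
  rw [one_div_mul_cancel this, one_smul]

theorem block_eq (N a b : ℕ) (hN : 0 < N) :
    Qa N a * (So N * Xo N) ^ (b + 1)
      - (if a = 0 then 0 else (1 / (N : ℚ)) • (Qa N (a - 1) * (So N * Xo N) ^ (b + 1)))
      - (if b = 0 then 0 else (1 / (N : ℚ)) • (Qa N a * (So N * Xo N) ^ b)) = Rb N a b := by
  have key : Qa N a * (So N * Xo N)
      - (if a = 0 then 0 else (1 / (N : ℚ)) • (Qa N (a - 1) * (So N * Xo N)))
      - (1 / (N : ℚ)) • Qa N a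
      = (Qa N a + if a = 0 then (1 / (N : ℚ)) • 1 else 0) * (Ts N * Xo N) := by
    have hxy := XY' N hN
    rcases a with _ | a
    · simp only [if_true, Qa, pow_zero, mul_one]
      have h2 : Ts N * Yo N * Xo N = (1 / (N : ℚ)) • (Ts N * Xo N) + (1 / (N : ℚ)) • (Ts N * Yo N) := by
        rw [mul_assoc, hxy, mul_add, mul_smul_comm, mul_smul_comm]
      simp only [add_mul, mul_add, one_mul, smul_mul_assoc, ← mul_assoc, h2]
      abel
    · simp only [Nat.add_eq_zero_iff, one_ne_zero, and_false, if_false, Nat.add_sub_cancel, add_zero]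
      have hq : Qa N (a + 1) = Qa N a * So N * Yo N := by
        unfold Qa
        rw [pow_succ]; simp only [mul_assoc]
      have h2 : Qa N (a + 1) * Xo N = (1 / (N : ℚ)) • (Qa N a * So N * Xo N) + (1 / (N : ℚ)) • Qa N (a + 1) := by
        rw [hq, mul_assoc, hxy, mul_add, mul_smul_comm, mul_smul_comm]
      have h3 : Qa N (a + 1) * (So N * Xo N) = Qa N (a+1) * Xo N + Qa N (a+1) * (Ts N * Xo N) := by
        rw [add_mul, mul_add, one_mul]
      rw [h3, h2, mul_assoc (Qa N a)]
      abel
  have key2 := congrArg (· * (So N * Xo N) ^ b) key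
  simp only [sub_mul, ite_mul, zero_mul, smul_mul_assoc] at key2
  have p1 : ∀ Z : Op, Z * (So N * Xo N) ^ (b + 1) = Z * (So N * Xo N) * (So N * Xo N) ^ b := by
    intro Z
    rw [pow_succ']; simp only [mul_assoc]
  rw [p1, p1]
  unfold Rb
  rcases b with _ | b
  · simp only [pow_zero, mul_one, if_true, and_true] at key2 ⊢
    rw [mul_add, ← key2]
    rcases a with _ | a
    · simp [add_mul, smul_smul, pow_two]
      abel
    · simp
  · simp only [Nat.add_eq_zero_iff, one_ne_zero, and_false, if_false, add_zero, sub_zero] at key2 ⊢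
    rw [key2]
    simp only [mul_assoc]

theorem Lb_K (N a b : ℕ) (hN : 0 < N) : Lb N a b * Kc N = Kc N * Rb N a b := by
  rw [← block_eq N a b hN]
  unfold Lb
  simp only [sub_mul, mul_sub, ite_mul, mul_ite, zero_mul, mul_zero, smul_mul_assoc, mul_smul_comm,
    Pa_X_K]

theorem Lb_Po (N a b : ℕ) : Lb N a b * Po N = Lb N a b := by
  unfold Lb
  have h : ∀ a b, Pa N a * Xo N ^ b * Po N = Pa N a * Xo N ^ b := by
    intro a b
    rcases b with _ | b
    · simp only [pow_zero, mul_one, Pa, mul_assoc, Dg_Po]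
    · rw [pow_succ]
      simp only [mul_assoc, Dg_Po]
  simp only [sub_mul, ite_mul, zero_mul, smul_mul_assoc, h]
theorem Ts_pred (N x : ℕ) (h0 : 0 < x) (hx : x < N) (ψ : ℕ → ℚ) :
    Ts N ψ (x - 1) = So N ψ x := by
  obtain ⟨y, rfl⟩ : ∃ y, x = y + 1 := ⟨x - 1, by omega⟩
  rw [Nat.add_sub_cancel, Ts_apply, sum_Ioo_step y N hx]
  rfl

theorem mono_cons {a N : ℕ} (x : Fin N) (y : Fin (a + 1) → Fin N) :
    Monotone (Fin.cons x y : Fin (a + 1 + 1) → Fin N) ↔ x ≤ y 0 ∧ Monotone y := by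
  constructor
  · intro h
    refine ⟨?_, ?_⟩
    · have := @h 0 (Fin.succ 0) (Fin.zero_le _)
      simpa using this
    · intro i j hij
      have := @h i.succ j.succ (Fin.succ_le_succ_iff.2 hij)
      simpa using this
  · rintro ⟨h1, h2⟩ i j hij
    rcases Fin.eq_zero_or_eq_succ i with rfl | ⟨i, rfl⟩
    · rcases Fin.eq_zero_or_eq_succ j with rfl | ⟨j, rfl⟩
      · exact le_rfl
      · simpa using h1.trans (h2 (Fin.zero_le j))
    · rcases Fin.eq_zero_or_eq_succ j with rfl | ⟨j, rfl⟩
      · exact absurd hij (by simp)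
      · simpa using h2 (Fin.succ_le_succ_iff.1 hij)

theorem mono_sum (N : ℕ) (w φ : ℕ → ℚ) (a : ℕ) : ∀ m : ℕ,
    (∑ x : Fin (a + 1) → Fin N,
      if Monotone x ∧ m < (x 0 : ℕ) then (∏ j, w (x j)) * φ (x (Fin.last a)) else 0) =
    (Ts N * Dg N w * (So N * Dg N w) ^ a) φ m := by
  induction a with
  | zero =>
    intro m
    rw [sum_fun_cons]
    simp only [pow_zero, mul_one, Module.End.mul_apply, Ts_apply]
    rw [← Fin_sum_Ioo]
    refine Finset.sum_congr rfl fun x _ => ?_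
    have hm : ∀ z : Fin 1 → Fin N, Monotone z := fun z => Subsingleton.monotone z
    simp only [hm, true_and]
    simp only [Finset.univ_unique, Finset.sum_singleton, Fin.cons_zero,
      Fin.last_zero]
    split_ifs with h
    · rw [Dg_apply, if_pos ⟨by omega, x.2⟩]
      congr 1
      exact Fin.prod_univ_one _
    · rfl
  | succ a ih =>
    intro m
    rw [sum_fun_cons, pow_succ', ← mul_assoc, mul_assoc (Ts N), mul_assoc (Ts N)]
    rw [Module.End.mul_apply, Ts_apply, ← Fin_sum_Ioo]
    refine Finset.sum_congr rfl fun x _ => ?_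
    split_ifs with hx
    · have h0 : 0 < (x : ℕ) := by omega
      rw [mul_assoc (Dg N w), mul_assoc (So N), Module.End.mul_apply, Module.End.mul_apply, Dg_apply, if_pos ⟨h0, x.2⟩,
        ← Ts_pred N x h0 x.2, ← Module.End.mul_apply, ← mul_assoc, ← ih, Finset.mul_sum]
      refine Finset.sum_congr rfl fun y _ => ?_
      have : (Monotone (Fin.cons x y : Fin (a + 1 + 1) → Fin N) ∧
          m < ((Fin.cons x y : Fin (a + 1 + 1) → Fin N) 0 : ℕ)) ↔
          (Monotone y ∧ (x : ℕ) - 1 < (y 0 : ℕ)) := by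
        rw [mono_cons, Fin.cons_zero, Fin.le_def]
        constructor
        · rintro ⟨⟨h1, h2⟩, h3⟩
          exact ⟨h2, by omega⟩
        · rintro ⟨h1, h2⟩
          exact ⟨⟨by omega, h1⟩, hx⟩
      simp only [this]
      split_ifs with h
      · rw [Fin.prod_univ_succ]
        simp only [Fin.cons_zero, Fin.cons_succ, ← Fin.succ_last]
        ring
      · simp
    · apply Finset.sum_eq_zero
      intro y _
      rw [if_neg]
      rintro ⟨_, h⟩
      exact hx h

/-- truncated `Hg` -/
noncomputable def Ht (N p : ℕ) (c : List ℕ) : ℕ → ℚ := fun m => if m < N then Hg N p c m else 0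

theorem Ht_cons (N p a : ℕ) (cs : List ℕ) :
    Ht N p ((a + 1) :: cs) = (Ts N * Dg N (wt N p) * (So N * Dg N (wt N p)) ^ a +
      if a = 0 then (1 / (N : ℚ)) • (1 : Op) else 0) (Ht N (p + 1) cs) := by
  ext m
  rw [LinearMap.add_apply, Pi.add_apply]
  by_cases hm : m < N
  · have h1 : Ht N p ((a + 1) :: cs) m = Hg N p ((a + 1) :: cs) m := if_pos hm
    have h2 : ∀ x : Fin N, Hg N (p + 1) cs x = Ht N (p + 1) cs x := fun x => (if_pos x.2).symm
    rw [h1, Hg_cons, Finset.sum_add_distrib]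
    simp only [h2]
    rw [mono_sum]
    congr 1
    by_cases ha : a = 0
    · subst ha
      have hmo : ∀ z : Fin (0 + 1) → Fin N, Monotone z := fun z => Subsingleton.monotone (α := Fin 1) z
      simp only [true_and, if_true, LinearMap.smul_apply, Module.End.one_apply, Pi.smul_apply,
        smul_eq_mul, hmo]
      rw [sum_fun_cons, Finset.sum_eq_single (⟨m, hm⟩ : Fin N)]
      · simp
      · intro b _ hb
        have : (b : ℕ) ≠ m := fun h => hb (Fin.ext h)
        simp [this]
      · simp
    · simp [ha]
  · have h1 : Ht N p ((a + 1) :: cs) m = 0 := if_neg hm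
    rw [h1, mul_assoc, Module.End.mul_apply, Ts_apply, Finset.Ioo_eq_empty_of_le (by omega)]
    split_ifs
    · simp [Ht, hm]
    · simp

theorem wt_zero (N : ℕ) : wt N 0 = wy N := by
  ext n
  simp [wt]
theorem wt_one (N : ℕ) : wt N 1 = wx := by
  ext n
  simp [wt]

theorem Hg_parity (N p : ℕ) (c : List ℕ) (m : ℕ) : Hg N (p + 2) c m = Hg N p c m := by
  unfold Hg wt
  have : ∀ i : ℕ, (i + (p + 2)) % 2 = (i + p) % 2 := by intro i; omega
  simp only [this]

theorem Ht_two (N a b : ℕ) (cs : List ℕ) :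
    Ht N 0 ((a + 1) :: (b + 1) :: cs) =
     ((Qa N a + if a = 0 then (1 / (N : ℚ)) • 1 else 0) *
      (Ts N * Xo N * (So N * Xo N) ^ b + if b = 0 then (1 / (N : ℚ)) • 1 else 0)) (Ht N 0 cs) := by
  have h : Ht N 2 cs = Ht N 0 cs := by
    ext m
    simp only [Ht]
    rw [Hg_parity N 0]
  rw [Ht_cons, Ht_cons, wt_zero, zero_add, wt_one, ← h]
  rfl

theorem Zg_op (N k : ℕ) (hk : 2 ≤ k) (ks : List ℕ) :
    Zg N (k :: ks) = (Ts N * Xo N ^ k) (Zg N ks) := by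
  have hp : ∀ (k : ℕ) (φ : ℕ → ℚ) (n : ℕ), 0 < n → n < N → (Xo N ^ k) φ n = (1 / (n : ℚ)) ^ k * φ n := by
    intro k φ n h0 h1
    induction k with
    | zero => simp
    | succ k ih =>
      rw [pow_succ', Module.End.mul_apply, Dg_apply, if_pos ⟨h0, h1⟩, ih]
      ring
  ext m
  rw [Zg_cons, Module.End.mul_apply, Ts_apply]
  refine Finset.sum_congr rfl fun n hn => ?_
  rw [Finset.mem_Ioo] at hn
  rw [hp k _ n (by omega) hn.2, if_neg (by omega), add_zero]

theorem Zg_op_one (N : ℕ) (ks : List ℕ) (ψ : ℕ → ℚ) (h : Zg N ks = Ts N ψ) :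
    Zg N (1 :: ks) = (Ts N * (Yo N * Uo N)) ψ := by
  have hop : Yo N * Uo N = Xo N * Ts N + Yo N * So N := by
    have := congrArg (· * Ts N) (XY N)
    simp only [smul_mul_assoc, add_mul] at this
    rw [mul_add, mul_add, mul_smul_comm, mul_one, ← mul_assoc, Dg_comm, this]
    abel
  rw [hop]
  ext m
  rw [Zg_cons, Module.End.mul_apply, Ts_apply]
  refine Finset.sum_congr rfl fun n hn => ?_
  rw [Finset.mem_Ioo] at hn
  have h0 : 0 < n := by omega
  rw [if_pos rfl, h, Ts_pred N n h0 hn.2]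
  simp only [LinearMap.add_apply (Xo N * Ts N), Pi.add_apply, Module.End.mul_apply, Dg_apply]
  rw [if_pos ⟨h0, hn.2⟩, if_pos ⟨h0, hn.2⟩, pow_one]

theorem Zg_block (N a b : ℕ) (hb : 1 ≤ b) (ks : List ℕ) :
    Zg N (List.replicate a 1 ++ (b + 1) :: ks) = (Pa N a * Xo N ^ b) (Zg N ks) := by
  have : ∀ a, Zg N (List.replicate a 1 ++ (b + 1) :: ks) =
      Ts N (((Yo N * Uo N) ^ a * Xo N ^ (b + 1)) (Zg N ks)) := by
    intro a
    induction a with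
    | zero =>
      simpa using Zg_op N (b + 1) (by omega) ks
    | succ a ih =>
      rw [List.replicate_succ, List.cons_append, Zg_op_one N _ _ ih, pow_succ' (Yo N * Uo N)]
      simp only [Module.End.mul_apply]
  rw [this, pow_succ', Pa]
  simp only [Module.End.mul_apply]

theorem Zg_build (N a b : ℕ) (hb : 1 ≤ b) (c : List ℕ) :
    Zg N (buildIdx ((a + 1) :: b :: c)) = (Pa N a * Xo N ^ b) (Zg N (buildIdx c)) := by
  rw [← Zg_block N a b hb]
  simp [buildIdx]
theorem modifyIdx_cons (x : ℕ) (c : List ℕ) (A B A' B' : Finset ℕ)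
    (hA : ∀ i, i + 1 ∈ A ↔ i ∈ A') (hB : ∀ i, i + 1 ∈ B ↔ i ∈ B') :
    modifyIdx (x :: c) A B =
      (if 0 ∈ A then [] else [x - if 0 ∈ B then 1 else 0]) ++ modifyIdx c A' B' := by
  unfold modifyIdx
  rw [List.length_cons, List.range_succ_eq_map, List.filter_cons, List.filter_map]
  have h1 : ((fun i => decide (i ∉ A)) ∘ Nat.succ) = fun i => decide (i ∉ A') := by
    funext i
    simp [hA]
  rw [h1]
  by_cases h0 : 0 ∈ A
  · simp [h0, hB, Function.comp_def]
  · simp [h0, hB, Function.comp_def]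

theorem mem_sE (A : Finset ℕ) (i : ℕ) : i + 1 ∈ A.map sE ↔ i ∈ A := by
  simp [sE]
theorem zero_sE (A : Finset ℕ) : 0 ∉ A.map sE := by
  simp [sE]

/-- left condition -/
def CL (c : List ℕ) (A : Finset ℕ) : Prop :=
  (∀ i ∈ A, 2 ≤ c.getD i 0) ∧ (∀ i, i % 2 = 0 → ¬(i ∈ A ∧ i + 1 ∈ A))
/-- right condition -/
def CR (c : List ℕ) (A : Finset ℕ) : Prop :=
  (∀ i ∈ A, c.getD i 0 = 1) ∧ OddEvenZ A

theorem forall_two (P : ℕ → Prop) : (∀ i, P i) ↔ P 0 ∧ P 1 ∧ ∀ i, P (i + 2) := by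
  constructor
  · intro h
    exact ⟨h 0, h 1, fun i => h _⟩
  · rintro ⟨h0, h1, h2⟩ i
    rcases i with _ | _ | i
    · exact h0
    · exact h1
    · exact h2 i

theorem CL_two (x y : ℕ) (c : List ℕ) (A B : Finset ℕ) (h : ∀ i, i + 2 ∈ B ↔ i ∈ A) :
    CL (x :: y :: c) B ↔ ((0 ∈ B → 2 ≤ x) ∧ (1 ∈ B → 2 ≤ y) ∧ ¬ (0 ∈ B ∧ 1 ∈ B)) ∧ CL c A := by
  unfold CL
  rw [forall_two, forall_two (fun i => i % 2 = 0 → ¬(i ∈ B ∧ i + 1 ∈ B))]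
  have h' : ∀ i, i + 2 + 1 ∈ B ↔ i + 1 ∈ A := fun i => h (i + 1)
  simp only [h, h', List.getD_cons_zero, List.getD_cons_succ, Nat.add_mod_right, Nat.zero_mod,
    zero_add, true_implies]
  norm_num
  tauto

theorem CR_two (x y : ℕ) (c : List ℕ) (A B : Finset ℕ) (h : ∀ i, i + 2 ∈ B ↔ i ∈ A) :
    CR (x :: y :: c) B ↔ ((0 ∈ B → x = 1) ∧ (1 ∈ B → y = 1) ∧ (0 ∈ B ↔ 1 ∈ B)) ∧ CR c A := by
  unfold CR OddEvenZ
  rw [forall_two, forall_two (fun i => i ∈ B → (i % 2 = 0 → i + 1 ∈ B) ∧ (i % 2 = 1 → i - 1 ∈ B))]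
  have h' : ∀ i, i + 2 + 1 ∈ B ↔ i + 1 ∈ A := fun i => h (i + 1)
  have h2 : (∀ i, i ∈ A → (i % 2 = 0 → i + 1 ∈ A) ∧ (i % 2 = 1 → i + 2 - 1 ∈ B)) ↔
     (∀ i, i ∈ A → (i % 2 = 0 → i + 1 ∈ A) ∧ (i % 2 = 1 → i - 1 ∈ A)) := by
    refine forall_congr' fun i => imp_congr_right fun _ => and_congr_right fun _ =>
      imp_congr_right fun hi => ?_
    rw [← h]
    have : i + 2 - 1 = i - 1 + 2 := by omega
    rw [this]
  simp only [h, h', List.getD_cons_zero, List.getD_cons_succ, Nat.add_mod_right, Nat.zero_mod,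
    zero_add, true_implies, h2]
  norm_num
  tauto

/-- left sum as a function of the lower bound -/
noncomputable def LS (N : ℕ) (c : List ℕ) : ℕ → ℚ :=
  ∑ A ∈ (Finset.range c.length).powerset,
    if CL c A then ((-1 : ℚ) ^ A.card * (1 / (N : ℚ)) ^ A.card) • Zg N (buildIdx (modifyIdx c ∅ A)) else 0

/-- right sum as a function of the lower bound -/
noncomputable def RS (N : ℕ) (c : List ℕ) : ℕ → ℚ :=
  ∑ A ∈ (Finset.range c.length).powerset,
    if CR c A then ((-1 : ℚ) ^ (A.card / 2) * (1 / (N : ℚ)) ^ A.card) • Ht N 0 (modifyIdx c A ∅) else 0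

theorem sum_range_powerset_two (l : ℕ) (F : Finset ℕ → ℕ → ℚ) :
    ∑ A ∈ (Finset.range (l + 2)).powerset, F A =
      ∑ A ∈ (Finset.range l).powerset, (F ((A.map sE).map sE) + F (insert 0 ((A.map sE).map sE)) +
        (F ((insert 0 (A.map sE)).map sE) + F (insert 0 ((insert 0 (A.map sE)).map sE)))) := by
  ext m
  simp only [Finset.sum_apply]
  rw [sum_range_powerset_succ, sum_range_powerset_succ]
  rfl

section four
variable (A : Finset ℕ)

theorem B0 (i : ℕ) : i + 2 ∈ (A.map sE).map sE ↔ i ∈ A := by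
  rw [mem_sE, mem_sE]
theorem B1 (i : ℕ) : i + 2 ∈ insert 0 ((A.map sE).map sE) ↔ i ∈ A := by
  rw [Finset.mem_insert, B0]; simp
theorem B2 (i : ℕ) : i + 2 ∈ (insert 0 (A.map sE)).map sE ↔ i ∈ A := by
  rw [mem_sE, Finset.mem_insert, mem_sE]; simp
theorem B3 (i : ℕ) : i + 2 ∈ insert 0 ((insert 0 (A.map sE)).map sE) ↔ i ∈ A := by
  rw [Finset.mem_insert, B2]; simp
theorem C01 : 1 ∉ (A.map sE).map sE := by
  rw [mem_sE]; exact zero_sE A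
theorem C11 : 1 ∉ insert 0 ((A.map sE).map sE) := by
  rw [Finset.mem_insert]; exact not_or.2 ⟨one_ne_zero, C01 A⟩
theorem C21 : 1 ∈ (insert 0 (A.map sE)).map sE := by
  rw [mem_sE]; simp
theorem C31 : 1 ∈ insert 0 ((insert 0 (A.map sE)).map sE) := by
  exact Finset.mem_insert_of_mem (C21 A)
theorem card1 : (insert 0 ((A.map sE).map sE)).card = A.card + 1 := by
  rw [Finset.card_insert_of_notMem (zero_sE _), Finset.card_map, Finset.card_map]
theorem card2 : ((insert 0 (A.map sE)).map sE).card = A.card + 1 := by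
  rw [Finset.card_map, Finset.card_insert_of_notMem (zero_sE _), Finset.card_map]
theorem card2b : (insert 0 (A.map sE)).card = A.card + 1 := by
  rw [Finset.card_insert_of_notMem (zero_sE _), Finset.card_map]
theorem card3 : (insert 0 ((insert 0 (A.map sE)).map sE)).card = A.card + 2 := by
  rw [Finset.card_insert_of_notMem (zero_sE _), card2]
end four

theorem modifyIdx_two (x y : ℕ) (c : List ℕ) (A B A' B' : Finset ℕ)
    (hA : ∀ i, i + 2 ∈ A ↔ i ∈ A') (hB : ∀ i, i + 2 ∈ B ↔ i ∈ B') :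
    modifyIdx (x :: y :: c) A B =
      (if 0 ∈ A then [] else [x - if 0 ∈ B then 1 else 0]) ++
      ((if 1 ∈ A then [] else [y - if 1 ∈ B then 1 else 0]) ++ modifyIdx c A' B') := by
  have hp : ∀ A : Finset ℕ, ∃ A1 : Finset ℕ, ∀ i, i + 1 ∈ A ↔ i ∈ A1 := by
    intro A
    refine ⟨(Finset.range (A.sup id + 1)).filter (fun i => i + 1 ∈ A), fun i => ?_⟩
    simp only [Finset.mem_filter, Finset.mem_range]
    constructor
    · intro h
      have := Finset.le_sup (f := id) h
      simp only [id] at this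
      exact ⟨by omega, h⟩
    · exact fun h => h.2
  obtain ⟨A1, hA1⟩ := hp A
  obtain ⟨B1, hB1⟩ := hp B
  rw [modifyIdx_cons x _ A B A1 B1 hA1 hB1,
    modifyIdx_cons y c A1 B1 A' B' (fun i => by rw [← hA1]; exact hA i)
      (fun i => by rw [← hB1]; exact hB i)]
  simp only [← hA1, ← hB1, zero_add]

theorem LS_two (N a b : ℕ) (c : List ℕ) :
    LS N ((a + 1) :: (b + 1) :: c) = Lb N a b (LS N c) := by
  unfold LS
  rw [map_sum]
  refine (sum_range_powerset_two c.length _).trans ?_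
  refine Finset.sum_congr rfl fun A _ => ?_
  have hE : ∀ i, i + 2 ∈ (∅ : Finset ℕ) ↔ i ∈ (∅ : Finset ℕ) := by simp
  rw [modifyIdx_two _ _ c ∅ _ ∅ A hE (B0 A), modifyIdx_two _ _ c ∅ _ ∅ A hE (B1 A),
    modifyIdx_two _ _ c ∅ _ ∅ A hE (B2 A), modifyIdx_two _ _ c ∅ _ ∅ A hE (B3 A)]
  simp only [CL_two _ _ c A _ (B0 A), CL_two _ _ c A _ (B1 A), CL_two _ _ c A _ (B2 A),
    CL_two _ _ c A _ (B3 A), C01, C11, C21, C31, zero_sE, Finset.mem_insert_self, card1, card2b,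
    Finset.card_map, false_implies, true_implies, and_true, true_and, not_true, not_false_eq_true,
    and_false, false_and, if_false, if_true, add_zero, Finset.notMem_empty, List.nil_append,
    List.cons_append, Nat.sub_zero, Nat.add_sub_cancel]
  by_cases h : CL c A
  · simp only [h, and_true, if_true]
    have hsq : ∀ k : ℕ, (-1 : ℚ) ^ (k + 1) * (1 / (N : ℚ)) ^ (k + 1) =
      -(((-1 : ℚ) ^ k * (1 / (N : ℚ)) ^ k) * (1 / (N : ℚ))) := by intro k; ring
    rw [map_smul, Zg_build N a (b + 1) (by omega), hsq, Lb]
    simp only [LinearMap.sub_apply]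
    have t1 : (if 2 ≤ a + 1 then
        (-((-1 : ℚ) ^ A.card * (1 / (N : ℚ)) ^ A.card * (1 / (N : ℚ)))) •
          Zg N (buildIdx (a :: (b + 1) :: modifyIdx c ∅ A)) else 0) =
        -(((-1 : ℚ) ^ A.card * (1 / (N : ℚ)) ^ A.card) •
          (if a = 0 then (0 : Op) else (1 / (N : ℚ)) • (Pa N (a - 1) * Xo N ^ (b + 1)))
            (Zg N (buildIdx (modifyIdx c ∅ A)))) := by
      rcases a with _ | a
      · simp
      · rw [if_pos (by omega), if_neg (by omega), Zg_build N a (b + 1) (by omega),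
          LinearMap.smul_apply, smul_smul, neg_smul, Nat.add_sub_cancel]
    have t2 : (if 2 ≤ b + 1 then
        (-((-1 : ℚ) ^ A.card * (1 / (N : ℚ)) ^ A.card * (1 / (N : ℚ)))) •
          Zg N (buildIdx ((a + 1) :: b :: modifyIdx c ∅ A)) else 0) =
        -(((-1 : ℚ) ^ A.card * (1 / (N : ℚ)) ^ A.card) •
          (if b = 0 then (0 : Op) else (1 / (N : ℚ)) • (Pa N a * Xo N ^ b))
            (Zg N (buildIdx (modifyIdx c ∅ A)))) := by
      rcases b with _ | b
      · simp
      · rw [if_pos (by omega), if_neg (by omega), Zg_build N a (b + 1) (by omega),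
          LinearMap.smul_apply, smul_smul, neg_smul]
    rw [t1, t2, smul_sub, smul_sub]
    abel
  · simp [h]

theorem RS_two (N a b : ℕ) (c : List ℕ) :
    RS N ((a + 1) :: (b + 1) :: c) = Rb N a b (RS N c) := by
  unfold RS
  rw [map_sum]
  refine (sum_range_powerset_two c.length _).trans ?_
  refine Finset.sum_congr rfl fun A _ => ?_
  have hE : ∀ i, i + 2 ∈ (∅ : Finset ℕ) ↔ i ∈ (∅ : Finset ℕ) := by simp
  rw [modifyIdx_two _ _ c _ ∅ A ∅ (B0 A) hE, modifyIdx_two _ _ c _ ∅ A ∅ (B1 A) hE,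
    modifyIdx_two _ _ c _ ∅ A ∅ (B2 A) hE, modifyIdx_two _ _ c _ ∅ A ∅ (B3 A) hE]
  simp only [CR_two _ _ c A _ (B0 A), CR_two _ _ c A _ (B1 A), CR_two _ _ c A _ (B2 A),
    CR_two _ _ c A _ (B3 A), C01, C11, C21, C31, zero_sE, Finset.mem_insert_self, card3,
    Finset.card_map, false_implies, true_implies, and_true, true_and, iff_false, iff_true, not_true,
    and_false, false_and, if_false, if_true, add_zero, zero_add, Finset.notMem_empty, List.nil_append,
    List.cons_append, Nat.sub_zero]
  by_cases h : CR c A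
  · simp only [h, and_true, if_true]
    have hsq : ∀ k : ℕ, (-1 : ℚ) ^ ((k + 2) / 2) * (1 / (N : ℚ)) ^ (k + 2) =
      -(((-1 : ℚ) ^ (k / 2) * (1 / (N : ℚ)) ^ k) * (1 / (N : ℚ)) ^ 2) := by
      intro k
      rw [Nat.add_div_right k (by norm_num)]
      ring
    rw [map_smul, Ht_two, hsq, Rb]
    simp only [LinearMap.sub_apply, smul_sub]
    have e : (a + 1 = 1 ∧ b + 1 = 1) ↔ (a = 0 ∧ b = 0) := by omega
    simp only [e]
    split_ifs
    all_goals simp [smul_smul, sub_eq_add_neg]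
  · simp [h]

theorem main_fn (N : ℕ) (hN : 0 < N) (s : ℕ) : ∀ c : List ℕ, c.length = 2 * s → (∀ x ∈ c, 0 < x) →
    ∀ n < N, LS N c n = Kc N (RS N c) n := by
  induction s with
  | zero =>
    intro c hc _ n hn
    have : c = [] := List.length_eq_zero_iff.1 (by omega)
    subst this
    have h1 : LS N [] = 1 := by
      ext m
      simp [LS, CL, modifyIdx, buildIdx, Zg_nil]
    have h2 : RS N [] = Ht N 0 [] := by
      simp [RS, CR, OddEvenZ, modifyIdx]
    rw [h1, h2]
    refine (K_one N n hn).symm.trans ?_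
    rw [Kc_apply, Kc_apply]
    refine Finset.sum_congr rfl fun m hm => ?_
    rw [Finset.mem_range] at hm
    simp [Ht, hm, Hg_nil]
  | succ s ih =>
    intro c hc hpos n hn
    match c, hc, hpos with
    | [], hc, _ => simp at hc
    | [x], hc, _ => simp at hc; omega
    | x :: y :: c, hc, hpos =>
      have hx := hpos x (by simp)
      have hy := hpos y (by simp)
      obtain ⟨a, rfl⟩ : ∃ a, x = a + 1 := ⟨x - 1, by omega⟩
      obtain ⟨b, rfl⟩ : ∃ b, y = b + 1 := ⟨y - 1, by omega⟩
      have hi := ih c (by simp at hc; omega) (fun z hz => hpos z (by simp [hz]))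
      have hP : Po N (LS N c) = Po N (Kc N (RS N c)) := by
        ext k
        simp only [Dg_apply]
        split_ifs with h
        · rw [hi k h.2]
        · rfl
      rw [LS_two, RS_two, ← Lb_Po, Module.End.mul_apply, hP, ← Module.End.mul_apply,
        ← Module.End.mul_apply, Lb_Po, Lb_K N a b hN, Module.End.mul_apply]

/-- **Lemma (f vs h).** -/
theorem f_eq_h (N s : ℕ) (hNpos : 0 < N) (hs : 0 < s) (c : List ℕ)
    (hlen : c.length = 2 * s) (hpos : ∀ x ∈ c, 0 < x) :
    (∑ A ∈ (Finset.range c.length).powerset,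
      if (∀ i ∈ A, 2 ≤ c.getD i 0) ∧ (∀ i, i % 2 = 0 → ¬(i ∈ A ∧ i + 1 ∈ A)) then
        (-1 : ℚ) ^ A.card * (1 / (N : ℚ)) ^ A.card * fN N (modifyIdx c ∅ A)
      else 0) =
    ∑ A ∈ (Finset.range c.length).powerset,
      if (∀ i ∈ A, c.getD i 0 = 1) ∧ OddEvenZ A then
        (-1 : ℚ) ^ (A.card / 2) * (1 / (N : ℚ)) ^ A.card * hN N (modifyIdx c A ∅)
      else 0 := by
  have h := main_fn N hNpos s c hlen hpos 0 hNpos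
  rw [K_zero N hNpos] at h
  refine Eq.trans ?_ (h.trans ?_)
  · simp only [LS, Finset.sum_apply]
    refine Finset.sum_congr rfl fun A _ => ?_
    rw [fN, zdiaL_eq]
    by_cases hc : CL c A
    · rw [if_pos hc]
      exact if_pos hc
    · rw [if_neg hc]
      exact if_neg hc
  · simp only [RS, Finset.sum_apply]
    refine Finset.sum_congr rfl fun A _ => ?_
    rw [hN_eq]
    by_cases hc : CR c A
    · rw [if_pos hc]
      refine Eq.trans ?_ (if_pos hc).symm
      simp [Ht, hNpos]
    · rw [if_neg hc]
      exact (if_neg hc).symm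
end

section
/- Let N and s be positive integers and c=(c_1,…,c_{2s}) a tuple of positive integers. Then h_N(c) = Σ over odd-even subsets A ⊂ [2s]^1_c, and over subsets B ⊂ [2s]^{>1}_c containing no pair {2r−1,2r} (r ∈ {1,…,s}), of (−1)^{#B}·N^{−(#A+#B)}·f_N(c_{(−A)}−δ_B). -/
open scoped Classical

namespace HF

open Matrix Finset

abbrev Mat (N : ℕ) := Matrix (Fin N) (Fin N) ℚ

def mU (N : ℕ) : Mat N := Matrix.of fun i j => if i < j then 1 else 0
def mW (N : ℕ) : Mat N := Matrix.of fun i j => if i ≤ j then 1 else 0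
def mD (N : ℕ) : Mat N := Matrix.diagonal fun i => 1 / ((i : ℕ) : ℚ)
def mE (N : ℕ) : Mat N := Matrix.diagonal fun i => 1 / ((N : ℚ) - ((i : ℕ) : ℚ))
def mQ (N : ℕ) : Mat N := Matrix.diagonal fun i => if (i : ℕ) = 0 then 0 else 1
/-- discrete version of `t ^ n` -/
def cC (N n m : ℕ) : ℚ := (m.choose n : ℚ) / ((N - 1).choose n : ℚ)
/-- differences of the connector -/
def cM (N n : ℕ) : ℕ → ℚ
  | 0 => if n = 0 then 1 else 0
  | m + 1 => cC N n (m + 1) - cC N n m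
def mM (N : ℕ) : Mat N := Matrix.of fun i j => cM N i j

lemma W_eq (N : ℕ) : mW N = mU N + 1 := by
  ext i j
  simp only [mW, mU, Matrix.of_apply, Matrix.add_apply, Matrix.one_apply]
  rcases lt_trichotomy i j with h | h | h
  · simp [h, h.le, h.ne]
  · simp [h]
  · simp [h.not_ge, h.not_gt, h.ne']

lemma UQ (N : ℕ) : mU N * mQ N = mU N := by
  ext i j
  simp only [mU, mQ, Matrix.mul_diagonal, Matrix.of_apply]
  by_cases h : i < j
  · have : (j : ℕ) ≠ 0 := by have := Fin.lt_def.1 h; omega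
    simp [h, this]
  · simp [h]

lemma QUQ (N : ℕ) : mQ N * mU N * mQ N = mQ N * mU N := by
  rw [mul_assoc, UQ]

lemma QWQ (N : ℕ) : mQ N * mW N * mQ N = mQ N * mW N := by
  ext i j
  simp only [mW, mQ, Matrix.mul_diagonal, Matrix.diagonal_mul, Matrix.of_apply]
  by_cases h : i ≤ j
  · by_cases h0 : (j : ℕ) = 0
    · have : (i : ℕ) = 0 := by have := Fin.le_def.1 h; omega
      simp [this]
    · simp [h0]
  · simp [h]

lemma QD (N : ℕ) : mQ N * mD N = mD N * mQ N := by
  simp [mQ, mD, Matrix.diagonal_mul_diagonal, mul_comm]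

lemma QE (N : ℕ) : mQ N * mE N = mE N * mQ N := by
  simp [mQ, mE, Matrix.diagonal_mul_diagonal, mul_comm]

lemma QQ (N : ℕ) : mQ N * mQ N = mQ N := by
  simp [mQ, Matrix.diagonal_mul_diagonal]

lemma QED (N : ℕ) : (N : ℚ) • (mQ N * (mE N * mD N)) = mQ N * (mD N + mE N) := by
  simp only [mQ, mD, mE, Matrix.diagonal_mul_diagonal, Matrix.diagonal_add, ← Matrix.diagonal_smul]
  congr 1
  funext i
  by_cases h : (i : ℕ) = 0
  · simp [h]
  · have h1 : ((i : ℕ) : ℚ) ≠ 0 := by exact_mod_cast h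
    have h2 : (N : ℚ) - ((i : ℕ) : ℚ) ≠ 0 := by
      have := i.2
      have : ((i : ℕ) : ℚ) < N := by exact_mod_cast this
      linarith
    simp only [h, if_false, Pi.smul_apply, smul_eq_mul]
    field_simp
    ring

/-! connector identities -/

lemma cC_zero (N m : ℕ) : cC N 0 m = 1 := by simp [cC]

lemma sum_cM (N n m : ℕ) : ∑ p ∈ range (m + 1), cM N n p = cC N n m := by
  induction m with
  | zero =>
    rcases n with _ | n
    · simp [cM, cC]
    · simp [cM, cC]
  | succ m ih => rw [sum_range_succ, ih]; simp [cM]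

lemma choose_ne {N n : ℕ} (h : n < N) : (((N - 1).choose n : ℕ) : ℚ) ≠ 0 := by
  have : 0 < (N - 1).choose n := Nat.choose_pos (by omega)
  exact_mod_cast this.ne'

/-- relation `m C(n,m-1) = (m-n) C(n,m)` -/
lemma cC_rel1 (N n m : ℕ) : ((m : ℚ) + 1) * cC N n m = ((m : ℚ) + 1 - n) * cC N n (m + 1) := by
  unfold cC
  have h := Nat.choose_mul_succ_eq m n
  by_cases hn : n ≤ m + 1
  · have h' : ((m.choose n : ℕ) : ℚ) * (m + 1) = ((m+1).choose n : ℕ) * ((m : ℚ) + 1 - n) := by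
      have := congrArg (Nat.cast : ℕ → ℚ) h
      push_cast [Nat.cast_sub hn] at this
      exact this
    rw [← mul_div_assoc, ← mul_div_assoc, mul_comm, h', mul_comm]
  · rw [Nat.choose_eq_zero_of_lt (by omega : m < n), Nat.choose_eq_zero_of_lt (by omega : m+1 < n)]
    simp

/-- relation in `n` -/
lemma cC_rel2 (N n m : ℕ) (hn : n + 1 < N) :
    ((N : ℚ) - 1 - n) * cC N (n + 1) m = ((m : ℚ) - n) * cC N n m := by
  unfold cC
  have key : ∀ a b : ℕ, ((a.choose (b + 1) : ℕ) : ℚ) * (b + 1) = (a.choose b : ℕ) * ((a : ℚ) - b) := by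
    intro a b
    have h := Nat.choose_succ_right_eq a b
    by_cases hb : b ≤ a
    · have := congrArg (Nat.cast : ℕ → ℚ) h
      push_cast [Nat.cast_sub hb] at this
      exact this
    · rw [Nat.choose_eq_zero_of_lt (by omega : a < b), Nat.choose_eq_zero_of_lt (by omega : a < b + 1)]
      simp
  have h1 := key m n
  have h2 := key (N - 1) n
  have hN : ((N - 1 : ℕ) : ℚ) = (N : ℚ) - 1 := by
    rw [Nat.cast_sub (by omega)]; simp
  rw [hN] at h2
  have n1 := choose_ne (N := N) (n := n) (by omega)
  have n2 := choose_ne (N := N) (n := n + 1) hn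
  have n3 : (n : ℚ) + 1 ≠ 0 := by positivity
  rw [mul_div_assoc', mul_div_assoc', div_eq_div_iff n2 n1]
  apply mul_right_cancel₀ n3
  linear_combination ((N:ℚ) - 1 - n) * ((N-1).choose n : ℚ) * h1 - ((m:ℚ) - n) * (m.choose n : ℚ) * h2

/-- `M(n,m)/n` is a difference -/
lemma cM_diff (N n m : ℕ) (hn : n + 1 < N) (hm : m + 1 < N) :
    1 / (((n + 1 : ℕ)) : ℚ) * cM N (n + 1) (m + 1) =
      (cC N n m - cC N (n + 1) m) * (1 / ((N : ℚ) - ((m + 1 : ℕ) : ℚ))) := by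
  have h1 := cC_rel1 N (n + 1) m
  have h2 := cC_rel2 N n m hn
  have h3 := cC_rel2 N n (m + 1) hn
  have h4 := cC_rel1 N n m
  have hN : (N : ℚ) - 1 - n ≠ 0 := by
    have : ((n + 1 : ℕ) : ℚ) < N := by exact_mod_cast hn
    push_cast at this; intro h; linarith
  have hM : (N : ℚ) - (m + 1) ≠ 0 := by
    have : ((m + 1 : ℕ) : ℚ) < N := by exact_mod_cast hm
    push_cast at this; intro h; linarith
  have hn1 : (n : ℚ) + 1 ≠ 0 := by positivity
  simp only [cM]
  push_cast at *
  field_simp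
  apply mul_left_cancel₀ hN
  linear_combination (N - (m:ℚ) - 1) * h3 - (N - (m:ℚ) - 1 - n - 1) * h2 + (-(N - (m:ℚ) - 1)) * h4


lemma tele (i N : ℕ) (T g : ℕ → ℚ) (hi : i < N)
    (h : ∀ k, i ≤ k → k + 1 < N → g (k + 1) = T k - T (k + 1)) :
    ∑ k ∈ range N, (if i < k then g k else 0) = T i - T (N - 1) := by
  induction N, hi using Nat.le_induction with
  | base =>
    rw [sum_eq_zero]
    · simp
    · intro k hk
      rw [mem_range] at hk
      rw [if_neg (by omega)]
  | succ n hn ih =>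
    rw [sum_range_succ, ih (fun k h1 h2 => h k h1 (by omega)), if_pos (by omega)]
    obtain ⟨k, rfl⟩ : ∃ k, n = k + 1 := ⟨n - 1, by omega⟩
    rw [h k (by omega) (by omega)]
    simp

lemma MW_apply (N : ℕ) (i j : Fin N) : (mM N * mW N) i j = cC N i j := by
  rw [Matrix.mul_apply, ← sum_cM]
  simp only [mM, mW, Matrix.of_apply, mul_ite, mul_one, mul_zero, Fin.le_def]
  rw [Fin.sum_univ_eq_sum_range (fun k => if k ≤ (j : ℕ) then cM N i k else 0) N, ← sum_filter]
  congr 1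
  ext k
  have := j.2
  simp only [mem_filter, mem_range]
  omega

lemma MU_apply (N : ℕ) (i j : Fin N) :
    (mM N * mU N) i j = if (j : ℕ) = 0 then 0 else cC N i (j - 1) := by
  rw [Matrix.mul_apply]
  simp only [mM, mU, Matrix.of_apply, mul_ite, mul_one, mul_zero, Fin.lt_def]
  rw [Fin.sum_univ_eq_sum_range (fun k => if k < (j : ℕ) then cM N i k else 0) N, ← sum_filter]
  split_ifs with h
  · rw [h]; simp
  · rw [← sum_cM]
    congr 1
    ext k
    have := j.2
    simp only [mem_filter, mem_range]
    omega

lemma cC_last_lt {N m : ℕ} (h : m < N - 1) : cC N (N - 1) m = 0 := by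
  simp [cC, Nat.choose_eq_zero_of_lt h]

lemma UDM (N : ℕ) : mU N * mD N * mM N = mM N * mU N * mE N := by
  ext i j
  rw [mul_assoc, Matrix.mul_apply, mE, Matrix.mul_diagonal, MU_apply]
  simp only [mU, mD, mM, Matrix.of_apply, Matrix.diagonal_mul, ite_mul, one_mul, zero_mul, Fin.lt_def]
  rw [Fin.sum_univ_eq_sum_range
    (fun k => if (i : ℕ) < k then 1 / (k : ℚ) * cM N k j else 0) N]
  rcases hj : (j : ℕ) with _ | m
  · simp only [if_true]
    apply sum_eq_zero
    intro k hk
    split_ifs with h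
    · simp only [cM]
      rw [if_neg (by omega)]; simp
    · rfl
  · have hm : m + 1 < N := by have := j.2; omega
    rw [tele i N (fun k => cC N k m * (1 / ((N : ℚ) - ((m + 1 : ℕ) : ℚ)))) _ i.2]
    · rw [cC_last_lt (by omega)]; simp
    · intro k _ hk
      rw [cM_diff N k m hk hm]; ring

lemma cM_succ_mul (N i m : ℕ) : ((m : ℚ) + 1) * cM N i (m + 1) = i * cC N i (m + 1) := by
  have := cC_rel1 N i m
  simp only [cM]
  linear_combination -this

lemma cM_pos_zero (N i : ℕ) (h : i ≠ 0) : cM N i 0 = 0 := by simp [cM, h]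

lemma cC_pos_zero (N i : ℕ) (h : i ≠ 0) : cC N i 0 = 0 := by
  simp [cC, Nat.choose_eq_zero_of_lt (Nat.pos_of_ne_zero h)]

lemma QDM (N : ℕ) : mQ N * (mD N * mM N) = mQ N * (mM N * mW N * mD N) := by
  ext i j
  rw [mQ, Matrix.diagonal_mul, Matrix.diagonal_mul, mD, Matrix.mul_diagonal, MW_apply,
    Matrix.diagonal_mul]
  by_cases hi : (i : ℕ) = 0
  · simp [hi]
  · have hi' : ((i : ℕ) : ℚ) ≠ 0 := by exact_mod_cast hi
    simp only [hi, if_false, one_mul, mM, Matrix.of_apply]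
    rcases hj : (j : ℕ) with _ | m
    · simp [cM_pos_zero N i hi]
    · have := cM_succ_mul N i m
      have hm : (m : ℚ) + 1 ≠ 0 := by positivity
      push_cast
      field_simp
      linear_combination this

def mR (N : ℕ) : Mat N := mD N * mU N + mE N * mW N

lemma QRDM (N : ℕ) : mQ N * (mR N * (mD N * mM N)) = mQ N * (mD N * mM N * mW N * mE N) := by
  have e1 : mQ N * (mR N * (mD N * mM N)) =
      mQ N * (mD N * (mM N * mU N * mE N) + mE N * (mM N * mU N * mE N))
        + mE N * (mQ N * (mM N * mW N * mD N)) := by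
    rw [← QDM, ← UDM, mR, W_eq, ← mul_assoc (mE N) (mQ N), ← QE]
    noncomm_ring
  rw [e1]
  ext i j
  rw [Matrix.add_apply, mul_assoc (mD N) (mM N), mul_assoc (mD N)]
  simp only [mQ, mD, mE, Matrix.diagonal_mul, Matrix.add_apply, Matrix.mul_diagonal, MU_apply, MW_apply]
  by_cases hi : (i : ℕ) = 0
  · simp [hi]
  · have hi' : ((i : ℕ) : ℚ) ≠ 0 := by exact_mod_cast hi
    have ne : ∀ k : Fin N, (N : ℚ) - ((k : ℕ) : ℚ) ≠ 0 := by
      intro k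
      have : ((k : ℕ) : ℚ) < N := by exact_mod_cast k.2
      linarith
    have h1 := ne i
    have h2 := ne j
    simp only [hi, if_false, one_mul]
    rcases hj : (j : ℕ) with _ | m
    · simp [cC_pos_zero N i hi]
    · have := cC_rel1 N i m
      rw [hj] at h2
      have hm : (m : ℚ) + 1 ≠ 0 := by positivity
      push_cast at *
      field_simp
      linear_combination (N : ℚ) * this

/-- `X` has zero column `0`. -/
def QR {N : ℕ} (X : Mat N) : Prop := X * mQ N = X

lemma QR.mulD {N : ℕ} {X : Mat N} (h : QR X) : QR (X * mD N) := by
  unfold QR at *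
  rw [mul_assoc, ← QD, ← mul_assoc, h]

lemma QR.mulE {N : ℕ} {X : Mat N} (h : QR X) : QR (X * mE N) := by
  unfold QR at *
  rw [mul_assoc, ← QE, ← mul_assoc, h]

lemma QR.mulU {N : ℕ} (X : Mat N) : QR (X * mU N) := by
  unfold QR at *
  rw [mul_assoc, UQ]

lemma QR.mulW {N : ℕ} {X : Mat N} (h : QR X) : QR (X * mW N) := by
  unfold QR at *
  have := QWQ N
  calc X * mW N * mQ N = X * mQ N * mW N * mQ N := by rw [h]
    _ = X * (mQ N * mW N * mQ N) := by noncomm_ring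
    _ = X * mQ N * mW N := by rw [this]; noncomm_ring
    _ = _ := by rw [h]

lemma QR.mulR {N : ℕ} {X : Mat N} (h : QR X) : QR (X * mR N) := by
  have h1 := QR.mulU (X * mD N)
  have h2 := h.mulE.mulW
  unfold QR mR at *
  rw [mul_add, add_mul, ← mul_assoc, ← mul_assoc, h1, h2]

lemma QR.eq {N : ℕ} {X Y Z : Mat N} (h : QR X) (e : mQ N * Y = mQ N * Z) : X * Y = X * Z := by
  unfold QR at h
  rw [← h, mul_assoc, e, ← mul_assoc]

lemma QR_U (N : ℕ) : QR (mU N) := UQ N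

def mF (N a b : ℕ) : Mat N := mU N * mR N ^ (a - 1) * mD N ^ (b + 1)
def mT (N a : ℕ) : Mat N := mU N * mE N * (mW N * mE N) ^ (a - 1)
def mK (N a b : ℕ) : Mat N := mT N a * (mW N * mD N) ^ b

lemma QR.DpowM {N : ℕ} {X : Mat N} (h : QR X) (b : ℕ) :
    X * mD N ^ b * mM N = X * mM N * (mW N * mD N) ^ b := by
  induction b generalizing X with
  | zero => simp
  | succ b ih =>
    have := ih h.mulD
    rw [pow_succ', ← mul_assoc, this, mul_assoc X, h.eq (QDM N), pow_succ']
    noncomm_ring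

lemma QR.RpowDM {N : ℕ} {X : Mat N} (h : QR X) (a : ℕ) :
    X * mR N ^ a * mD N * mM N = X * mD N * mM N * (mW N * mE N) ^ a := by
  induction a generalizing X with
  | zero => simp
  | succ a ih =>
    have := ih h.mulR
    rw [pow_succ', ← mul_assoc, this, mul_assoc (X * mR N) (mD N), mul_assoc X (mR N), h.eq (QRDM N), pow_succ']
    noncomm_ring

lemma QR.Rpow {N : ℕ} {X : Mat N} (h : QR X) (a : ℕ) : QR (X * mR N ^ a) := by
  induction a with
  | zero => simpa using h
  | succ a ih => rw [pow_succ, ← mul_assoc]; exact ih.mulR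

lemma FM (N a b : ℕ) : mF N a b * mM N = mM N * mK N a b := by
  unfold mF mK mT
  have h := (QR_U N).Rpow (a - 1)
  rw [pow_succ', ← mul_assoc, h.mulD.DpowM, (QR_U N).RpowDM, UDM]
  noncomm_ring

lemma QR_T (N a : ℕ) : QR (mT N a) := by
  unfold mT
  induction (a - 1) with
  | zero => simpa using (QR_U N).mulE
  | succ a ih => rw [pow_succ, ← mul_assoc, ← mul_assoc]; exact ih.mulW.mulE

lemma QR.ED {N : ℕ} {X : Mat N} (hN : 0 < N) (h : QR X) :
    X * mE N * mD N = (1 / (N : ℚ)) • (X * mD N + X * mE N) := by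
  have := QED N
  have hN' : (N : ℚ) ≠ 0 := by exact_mod_cast hN.ne'
  have e := h.eq (Y := (N : ℚ) • (mE N * mD N)) (Z := mD N + mE N) (by rw [← this]; simp)
  rw [← mul_add, ← e, mul_assoc]
  simp [smul_smul, hN']

def mHo (N a : ℕ) : Mat N := mT N a + (if a = 1 then (1 / (N : ℚ)) • 1 else 0)
def mHe (N b : ℕ) : Mat N := mU N * mD N * (mW N * mD N) ^ (b - 1) + (if b = 1 then (1 / (N : ℚ)) • 1 else 0)

lemma T_D (N a : ℕ) (hN : 0 < N) (ha : 0 < a) : mT N a * mD N =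
    (1 / (N : ℚ)) • ((if a = 1 then mU N * mD N else mT N (a - 1) * (mW N * mD N)) + mT N a) := by
  obtain ⟨a, rfl⟩ : ∃ k, a = k + 1 := ⟨a - 1, by omega⟩
  rcases a with _ | a
  · simpa [mT] using (QR_U N).ED hN
  · have e : mT N (a + 1 + 1) = mT N (a + 1) * mW N * mE N := by
      simp only [mT, Nat.add_sub_cancel, pow_succ]
      noncomm_ring
    have := (QR_T N (a + 1)).mulW.ED hN
    rw [e, this]
    simp [mul_assoc]

lemma HH (N a b : ℕ) (hN : 0 < N) (ha : 0 < a) (hb : 0 < b) : mHo N a * mHe N b =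
    mK N a b - (1 / (N : ℚ)) • (if a = 1 then 0 else mK N (a - 1) b)
     - (1 / (N : ℚ)) • (if b = 1 then 0 else mK N a (b - 1))
     + (if a = 1 ∧ b = 1 then (1 / (N : ℚ)) ^ 2 else 0) • 1 := by
  obtain ⟨b, rfl⟩ : ∃ k, b = k + 1 := ⟨b - 1, by omega⟩
  have hU : mU N = mW N - 1 := by rw [W_eq]; simp
  have e1 : mT N a * (mU N * mD N * (mW N * mD N) ^ b) =
      mK N a (b + 1) - mT N a * mD N * (mW N * mD N) ^ b := by
    rw [hU, mK, pow_succ']; noncomm_ring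
  rw [T_D N a hN ha] at e1
  simp only [mHo, mHe, Nat.add_sub_cancel]
  rw [mul_add, add_mul, e1]
  by_cases h1 : a = 1 <;> by_cases h2 : b = 0
  · subst h1 h2
    simp [mK, smul_smul, pow_two]
    abel
  · subst h1
    simp [h2, mK, add_mul]
    abel
  · subst h2
    simp [h1, mK]
    abel
  · simp only [h1, h2, mK, if_false, Nat.add_eq_right, add_mul, smul_add, smul_mul_assoc, pow_succ']
    simp only [mul_assoc, mul_zero, add_zero, zero_mul, false_and, if_false, zero_smul]
    abel

lemma M_one (N : ℕ) : (mM N) *ᵥ (fun _ => (1 : ℚ)) = fun _ => 1 := by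
  funext i
  simp only [Matrix.mulVec, dotProduct, mM, Matrix.of_apply, mul_one]
  rw [Fin.sum_univ_eq_sum_range (fun k => cM N i k) N]
  have hN : N = (N - 1) + 1 := by have := i.2; omega
  have := sum_cM N i (N - 1)
  rw [← hN] at this
  rw [this, cC, div_self (choose_ne i.2)]

lemma M_zero (N : ℕ) (hN : 0 < N) (φ : Fin N → ℚ) : (mM N *ᵥ φ) ⟨0, hN⟩ = φ ⟨0, hN⟩ := by
  have : ∀ j : Fin N, mM N ⟨0, hN⟩ j = if j = ⟨0, hN⟩ then 1 else 0 := by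
    intro j
    simp only [mM, Matrix.of_apply, Fin.ext_iff]
    rcases (j : ℕ) with _ | m
    · simp [cM]
    · simp [cM, cC_zero]
  simp [Matrix.mulVec, dotProduct, this]


/-- extend a subset of `Fin n` to `Fin (n+1)` -/
def up {n : ℕ} (x : Bool) (A : Finset (Fin n)) : Finset (Fin (n + 1)) :=
  (if x then {0} else ∅) ∪ A.map (Fin.succEmb n)

@[simp] lemma zero_mem_up {n : ℕ} (x : Bool) (A : Finset (Fin n)) : 0 ∈ up x A ↔ x = true := by
  cases x <;> simp [up]

@[simp] lemma succ_mem_up {n : ℕ} (x : Bool) (A : Finset (Fin n)) (i : Fin n) :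
    i.succ ∈ up x A ↔ i ∈ A := by
  cases x <;> simp [up]

lemma card_up {n : ℕ} (x : Bool) (A : Finset (Fin n)) : (up x A).card = x.toNat + A.card := by
  unfold up
  rw [card_union_of_disjoint]
  · cases x <;> simp
  · cases x <;> simp

noncomputable def upEquiv (n : ℕ) : Bool × Finset (Fin n) ≃ Finset (Fin (n + 1)) where
  toFun p := up p.1 p.2
  invFun B := (decide (0 ∈ B), univ.filter fun i : Fin n => i.succ ∈ B)
  left_inv p := by
    ext <;> simp
  right_inv B := by
    ext i
    refine Fin.cases ?_ (fun i => ?_) i <;> simp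

lemma sum_up {n : ℕ} (F : Finset (Fin (n + 1)) → ℚ) :
    ∑ A, F A = ∑ A : Finset (Fin n), (F (up false A) + F (up true A)) := by
  rw [← (upEquiv n).sum_comp, Fintype.sum_prod_type, Fintype.sum_bool, sum_add_distrib, add_comm]
  rfl

lemma sum_consFn {n : ℕ} {α : Fin (n + 1) → Type} [∀ i, Fintype (α i)] (F : (∀ i, α i) → ℚ) :
    ∑ f, F f = ∑ x : α 0, ∑ g : ∀ i : Fin n, α i.succ, F (Fin.cons x g) := by
  rw [← (Fin.consEquiv α).sum_comp, Fintype.sum_prod_type]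
  rfl

/-- indicator of a proposition -/
noncomputable def ind (p : Prop) : ℚ := @ite ℚ p (Classical.propDecidable p) 1 0

lemma ite_ind (p : Prop) [Decidable p] (x : ℚ) : (if p then x else 0) = ind p * x := by
  unfold ind
  by_cases h : p <;> simp [h]

lemma ind_pos {p : Prop} (h : p) : ind p = 1 := by simp [ind, h]

lemma ind_neg {p : Prop} (h : ¬ p) : ind p = 0 := by simp [ind, h]

lemma ind_and (p q : Prop) : ind (p ∧ q) = ind p * ind q := by
  by_cases h : p <;> by_cases h' : q <;> simp [ind, h, h']

lemma ind_congr {p q : Prop} (h : p ↔ q) : ind p = ind q := by rw [propext h]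

def zChain (N : ℕ) (k : List ℕ) (A : Finset (Fin k.length)) (n : Fin k.length → Fin N) : Prop :=
  ∀ (i : Fin k.length) (h : (i : ℕ) + 1 < k.length),
    (i ∈ A → n i ≤ n ⟨(i : ℕ) + 1, h⟩) ∧ (i ∉ A → n i < n ⟨(i : ℕ) + 1, h⟩)

noncomputable def zProd (N : ℕ) (k : List ℕ) (A : Finset (Fin k.length)) (n : Fin k.length → Fin N) : ℚ :=
  ∏ i : Fin k.length,
    if i ∈ A then (1 : ℚ) / ((N : ℚ) - ((n i : ℕ) : ℚ))
    else (1 : ℚ) / (((n i : ℕ) : ℚ) ^ k.get i)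

def zStart (N : ℕ) (k : List ℕ) (p : Fin N → Prop) (n : Fin k.length → Fin N) : Prop :=
  ∀ i : Fin k.length, (i : ℕ) = 0 → p (n i)

def zOne (k : List ℕ) (A : Finset (Fin k.length)) : Prop := ∀ i ∈ A, k.get i = 1

noncomputable def zSum (N : ℕ) (k : List ℕ) (p : Fin N → Prop) : ℚ :=
  ∑ A : Finset (Fin k.length), ∑ n : Fin k.length → Fin N,
    ind (zOne k A) * ind (zStart N k p n) * ind (zChain N k A n) * zProd N k A n

lemma ite_imp {p a b : Prop} [Decidable p] : (if p then a else b) ↔ ((p → a) ∧ (¬ p → b)) := by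
  by_cases h : p <;> simp [h]

lemma zdiaL_eq (N : ℕ) (k : List ℕ) : zdiaL N k = zSum N k (fun x => 0 < (x : ℕ)) := by
  unfold zdiaL zSum
  apply sum_congr rfl
  intro A _
  rw [ite_ind, sum_filter, mul_sum]
  apply sum_congr rfl
  intro n _
  rw [ite_ind, mul_assoc, mul_assoc, ← mul_assoc (ind (zStart _ _ _ _)), ← ind_and]
  congr 2
  apply ind_congr
  simp only [ite_imp]
  constructor
  · rintro ⟨h1, h2⟩
    exact ⟨fun i _ => h1 i, h2⟩
  · rintro ⟨h1, h2⟩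
    refine ⟨?_, h2⟩
    have : ∀ (i : ℕ) (hi : i < k.length), 0 < (n ⟨i, hi⟩ : ℕ) := by
      intro i
      induction i with
      | zero => intro hi; exact h1 _ rfl
      | succ i ih =>
        intro hi
        have a := ih (by omega)
        have b := h2 ⟨i, by omega⟩ hi
        by_cases hA : (⟨i, by omega⟩ : Fin k.length) ∈ A
        · exact lt_of_lt_of_le a (Fin.le_def.1 (b.1 hA))
        · exact lt_trans a (Fin.lt_def.1 (b.2 hA))
    intro i
    exact this i i.2

lemma zChain_cons (N k : ℕ) (l : List ℕ) (b : Bool) (A : Finset (Fin l.length)) (x : Fin N)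
    (n : Fin l.length → Fin N) :
    zChain N (k :: l) (up b A) (Fin.cons x n : Fin (l.length + 1) → Fin N) ↔
      zStart N l (fun y => if b = true then x ≤ y else x < y) n ∧ zChain N l A n := by
  constructor
  · intro h
    refine ⟨?_, ?_⟩
    · rintro ⟨i, hi⟩ h0
      simp only at h0
      subst h0
      have := h (0 : Fin (l.length + 1)) (by simpa using hi)
      rw [zero_mem_up, ← ite_imp] at this
      exact this
    · intro i hi
      have := h i.succ (by simpa using hi)
      rw [succ_mem_up] at this
      exact this
  · rintro ⟨h1, h2⟩ i
    refine Fin.cases ?_ (fun i => ?_) i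
    · intro hi
      rw [zero_mem_up, ← ite_imp]
      exact h1 ⟨0, by simpa using hi⟩ rfl
    · intro hi
      rw [succ_mem_up]
      exact h2 i (by simpa using hi)

lemma zProd_cons (N k : ℕ) (l : List ℕ) (b : Bool) (A : Finset (Fin l.length)) (x : Fin N)
    (n : Fin l.length → Fin N) :
    zProd N (k :: l) (up b A) (Fin.cons x n : Fin (l.length + 1) → Fin N) =
      (if b = true then (1 : ℚ) / ((N : ℚ) - ((x : ℕ) : ℚ)) else (1 : ℚ) / (((x : ℕ) : ℚ) ^ k)) *
        zProd N l A n := by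
  unfold zProd
  refine (Fin.prod_univ_succ (n := l.length) _).trans ?_
  simp only [zero_mem_up, succ_mem_up]
  rfl

lemma zOne_cons (k : ℕ) (l : List ℕ) (b : Bool) (A : Finset (Fin l.length)) :
    zOne (k :: l) (up b A) ↔ (b = true → k = 1) ∧ zOne l A := by
  constructor
  · intro h
    refine ⟨fun hb => h (0 : Fin (l.length + 1)) (by simpa using hb), fun i hi => h i.succ ?_⟩
    rw [succ_mem_up]; exact hi
  · rintro ⟨h1, h2⟩ i
    refine Fin.cases ?_ (fun i => ?_) i
    · intro hi
      rw [zero_mem_up] at hi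
      exact h1 hi
    · intro hi
      rw [succ_mem_up] at hi
      exact h2 i hi

lemma zStart_cons {N : ℕ} (l : List ℕ) (k : ℕ) (x : Fin N) (n : Fin l.length → Fin N) (p : Fin N → Prop) :
    zStart N (k :: l) p (Fin.cons x n : Fin (l.length + 1) → Fin N) ↔ p x := by
  constructor
  · intro h; exact h (0 : Fin (l.length + 1)) rfl
  · intro h i
    refine Fin.cases ?_ (fun i => ?_) i
    · intro _; exact h
    · intro hi; simp at hi

lemma zSum_cons (N k : ℕ) (l : List ℕ) (p : Fin N → Prop) :
    zSum N (k :: l) p = ∑ x : Fin N, ind (p x) * (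
      1 / ((x : ℕ) : ℚ) ^ k * zSum N l (fun y => x < y) +
      ind (k = 1) * (1 / ((N : ℚ) - ((x : ℕ) : ℚ)) * zSum N l (fun y => x ≤ y))) := by
  have e : zSum N (k :: l) p = ∑ A : Finset (Fin l.length), ∑ x : Fin N, ∑ n : Fin l.length → Fin N,
      ((ind (p x) * (1 / ((x : ℕ) : ℚ) ^ k)) *
        (ind (zOne l A) * ind (zStart N l (fun y => x < y) n) * ind (zChain N l A n) * zProd N l A n)
       + (ind (p x) * ind (k = 1) * (1 / ((N : ℚ) - ((x : ℕ) : ℚ)))) *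
        (ind (zOne l A) * ind (zStart N l (fun y => x ≤ y) n) * ind (zChain N l A n) * zProd N l A n)) := by
    unfold zSum
    refine (sum_up (n := l.length) _).trans ?_
    apply sum_congr rfl
    intro A _
    rw [← sum_add_distrib]
    refine (sum_consFn (n := l.length) (α := fun _ => Fin N) _).trans ?_
    apply sum_congr rfl
    intro x _
    apply sum_congr rfl
    intro n _
    rw [zProd_cons, zProd_cons]
    rw [ind_congr (zOne_cons k l false A), ind_congr (zOne_cons k l true A),
      ind_congr (zStart_cons l k x n p), ind_congr (zChain_cons N k l false A x n),
      ind_congr (zChain_cons N k l true A x n)]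
    simp only [ind_and, if_true, Bool.false_eq_true, if_false, false_imp_iff, true_imp_iff,
      ind_pos trivial]
    ring
  rw [e, sum_comm]
  apply sum_congr rfl
  intro x _
  simp only [sum_add_distrib, ← mul_sum]
  unfold zSum
  ring

lemma zSum_nil (N : ℕ) (p : Fin N → Prop) : zSum N [] p = 1 := by
  unfold zSum
  simp [zChain, zProd, zOne, zStart, ind]

/-- strict-start vector -/
noncomputable def zG (N : ℕ) (k : List ℕ) : Fin N → ℚ := fun x => zSum N k (fun y => x < y)

noncomputable def zW (N : ℕ) (k : List ℕ) : Fin N → ℚ := fun x => zSum N k (fun y => x ≤ y)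

lemma D_pow_mulVec (N k : ℕ) (v : Fin N → ℚ) (x : Fin N) :
    (mD N ^ k *ᵥ v) x = 1 / ((x : ℕ) : ℚ) ^ k * v x := by
  rw [mD, Matrix.diagonal_pow, Matrix.mulVec_diagonal]
  simp

lemma E_mulVec (N : ℕ) (v : Fin N → ℚ) (x : Fin N) :
    (mE N *ᵥ v) x = 1 / ((N : ℚ) - ((x : ℕ) : ℚ)) * v x := by
  rw [mE, Matrix.mulVec_diagonal]

noncomputable def zV (N k : ℕ) (l : List ℕ) : Fin N → ℚ :=
  mD N ^ k *ᵥ zG N l + (if k = 1 then mE N *ᵥ zW N l else 0)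

lemma zSum_cons' (N k : ℕ) (l : List ℕ) (p : Fin N → Prop) :
    zSum N (k :: l) p = ∑ x : Fin N, ind (p x) * zV N k l x := by
  rw [zSum_cons]
  apply sum_congr rfl
  intro x _
  congr 1
  rw [zV, Pi.add_apply, D_pow_mulVec]
  by_cases hk : k = 1
  · simp only [hk, if_true, E_mulVec, ind_pos, one_mul]; rfl
  · simp only [hk, if_false, ind_neg not_false, zero_mul]; rfl

lemma zG_cons (N k : ℕ) (l : List ℕ) : zG N (k :: l) = mU N *ᵥ zV N k l := by
  funext x
  rw [zG, zSum_cons']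
  simp only [Matrix.mulVec, dotProduct, mU, Matrix.of_apply, ite_ind, mul_one]

lemma zW_cons (N k : ℕ) (l : List ℕ) : zW N (k :: l) = mW N *ᵥ zV N k l := by
  funext x
  rw [zW, zSum_cons']
  simp only [Matrix.mulVec, dotProduct, mW, Matrix.of_apply, ite_ind, mul_one]

lemma zV_one (N k : ℕ) (l : List ℕ) : zV N 1 (k :: l) = mR N *ᵥ zV N k l := by
  rw [zV, zG_cons, zW_cons, mR, Matrix.add_mulVec]
  simp

lemma zG_block (N a b : ℕ) (l : List ℕ) (hb : 0 < b) :
    zG N ((List.replicate a 1 ++ [b + 1]) ++ l) =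
      (mU N * mR N ^ a * mD N ^ (b + 1)) *ᵥ zG N l := by
  have : ∀ a, ∃ k l', (List.replicate a 1 ++ [b + 1]) ++ l = k :: l' ∧
      zV N k l' = (mR N ^ a * mD N ^ (b + 1)) *ᵥ zG N l := by
    intro a
    induction a with
    | zero => 
      refine ⟨b + 1, l, by simp, ?_⟩
      simp [zV]
      omega
    | succ a ih =>
      obtain ⟨k, l', h1, h2⟩ := ih
      refine ⟨1, k :: l', by rw [← h1]; simp [List.replicate_succ], ?_⟩
      rw [zV_one, h2, Matrix.mulVec_mulVec, pow_succ' (mR N), mul_assoc]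
  obtain ⟨k, l', h1, h2⟩ := this a
  rw [h1, zG_cons, h2, Matrix.mulVec_mulVec, mul_assoc]

noncomputable def fV (N : ℕ) (c : List ℕ) : Fin N → ℚ := zG N (buildIdx c)

lemma fV_cons (N a b : ℕ) (l : List ℕ) (hb : 0 < b) :
    fV N (a :: b :: l) = mF N a b *ᵥ fV N l := by
  unfold fV
  rw [buildIdx, zG_block N (a - 1) b _ hb]
  rfl

lemma fV_nil (N : ℕ) : fV N [] = fun _ => 1 := by
  funext x
  simp [fV, buildIdx, zG, zSum_nil]

lemma fN_eq (N : ℕ) (hN : 0 < N) (c : List ℕ) : fN N c = fV N c ⟨0, hN⟩ := by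
  unfold fN fV zG
  rw [zdiaL_eq]
  rfl


abbrev HT (N : ℕ) (c : List ℕ) := ∀ i : Fin c.length, Fin (c.get i) → Fin N

def hMono {N : ℕ} (c : List ℕ) (n : HT N c) : Prop := ∀ i, Monotone (n i)

def hLink {N : ℕ} (c : List ℕ) (A : Finset (Fin c.length)) (n : HT N c) (m : ℕ) : Prop :=
  ∀ (j : Fin c.length) (b : Fin (c.get j)), (b : ℕ) = 0 →
    (((j : ℕ) = 0 → (j ∈ A → (n j b : ℕ) = m) ∧ (j ∉ A → m < (n j b : ℕ))) ∧
     ((j : ℕ) ≠ 0 → ∀ (j' : Fin c.length) (a : Fin (c.get j')),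
        (j' : ℕ) + 1 = (j : ℕ) → (a : ℕ) + 1 = c.get j' →
          (j ∈ A → (n j' a : ℕ) = (n j b : ℕ)) ∧ (j ∉ A → (n j' a : ℕ) < (n j b : ℕ))))

noncomputable def hw (N par : ℕ) (x : Fin N) : ℚ :=
  if par % 2 = 0 then (1 : ℚ) / ((N : ℚ) - ((x : ℕ) : ℚ)) else (1 : ℚ) / ((x : ℕ) : ℚ)

noncomputable def hProd {N : ℕ} (c : List ℕ) (par : ℕ) (A : Finset (Fin c.length)) (n : HT N c) : ℚ :=
  ∏ i : Fin c.length, ∏ j : Fin (c.get i), if i ∈ A then 1 else hw N (i + par) (n i j)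

noncomputable def hSum (N : ℕ) (c : List ℕ) (par m : ℕ) : ℚ :=
  ∑ A : Finset (Fin c.length), ∑ n : HT N c,
    ind (zOne c A) * (1 / (N : ℚ)) ^ A.card * ind (hMono c n) * ind (hLink c A n m) * hProd c par A n

lemma hN_eq (N : ℕ) (c : List ℕ) : hN N c = hSum N c 0 0 := by
  unfold hN hSum
  apply sum_congr rfl
  intro A _
  rw [ite_ind, sum_filter, mul_sum, mul_sum]
  apply sum_congr rfl
  intro n _
  rw [ite_ind, ← mul_assoc, ← mul_assoc, mul_assoc _ (ind (hMono _ _)), ← ind_and]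
  congr 2
  apply ind_congr
  simp only [ite_imp]
  rfl

lemma hMono_cons {N : ℕ} (a : ℕ) (l : List ℕ) (q : Fin a → Fin N) (n : HT N l) :
    hMono (a :: l) (Fin.cons (α := fun i : Fin (l.length + 1) => Fin ((a :: l).get i) → Fin N) q n) ↔
      Monotone q ∧ hMono l n := by
  constructor
  · intro h
    exact ⟨h (0 : Fin (l.length + 1)), fun i => h i.succ⟩
  · rintro ⟨h1, h2⟩ i
    refine Fin.cases ?_ (fun i => ?_) i
    · exact h1
    · exact h2 i

lemma hLink_cons {N : ℕ} (a : ℕ) (l : List ℕ) (x : Bool) (A : Finset (Fin l.length)) (m : ℕ)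
    (q : Fin (a + 1) → Fin N) (n : HT N l) :
    hLink ((a + 1) :: l) (up x A)
      (Fin.cons (α := fun i : Fin (l.length + 1) => Fin (((a + 1) :: l).get i) → Fin N) q n) m ↔
      ((x = true → (q 0 : ℕ) = m) ∧ (x ≠ true → m < (q 0 : ℕ))) ∧ hLink l A n (q (Fin.last a)) := by
  constructor
  · intro h
    refine ⟨?_, ?_⟩
    · have := (h (0 : Fin (l.length + 1)) (0 : Fin (a + 1)) rfl).1 rfl
      rw [zero_mem_up] at this
      exact this
    · intro j b hb
      have h2 := (h j.succ b hb).2 (by simp)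
      rw [succ_mem_up] at h2
      refine ⟨?_, ?_⟩
      · intro h0
        have := h2 (0 : Fin (l.length + 1)) (Fin.last a) (by simp [h0]) rfl
        refine ⟨fun hA => (this.1 hA).symm, this.2⟩
      · intro h0 j' a' h3 h4
        exact h2 j'.succ a' (by simp [← h3]) h4
  · rintro ⟨h1, h2⟩ j
    refine Fin.cases ?_ (fun j => ?_) j
    · intro b hb
      refine ⟨fun _ => ?_, fun h => absurd rfl h⟩
      rw [zero_mem_up]
      have : b = (0 : Fin (a + 1)) := Fin.ext hb
      rw [this]
      exact h1
    · intro b hb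
      refine ⟨fun h => by simp at h, fun _ j' => ?_⟩
      rw [succ_mem_up]
      refine Fin.cases ?_ (fun j' => ?_) j'
      · intro a' h3 h4
        have : a' = Fin.last a := by
          apply Fin.ext
          have : (a' : ℕ) + 1 = a + 1 := h4
          simpa using this
        rw [this]
        have h5 := (h2 j b hb).1 (by simpa using h3.symm)
        exact ⟨fun hA => (h5.1 hA).symm, h5.2⟩
      · intro a' h3 h4
        have h3' : (j' : ℕ) + 1 = j := by simpa using h3
        exact (h2 j b hb).2 (by omega) j' a' h3' h4

lemma hProd_cons {N : ℕ} (a : ℕ) (l : List ℕ) (par : ℕ) (x : Bool) (A : Finset (Fin l.length))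
    (q : Fin a → Fin N) (n : HT N l) :
    hProd (a :: l) par (up x A)
      (Fin.cons (α := fun i : Fin (l.length + 1) => Fin ((a :: l).get i) → Fin N) q n) =
      (∏ j : Fin a, if x = true then 1 else hw N par (q j)) * hProd l (par + 1) A n := by
  unfold hProd
  refine (Fin.prod_univ_succ (n := l.length) _).trans ?_
  congr 1
  · simp only [zero_mem_up]
    apply prod_congr rfl
    intro j _
    simp only [Fin.val_zero, zero_add]
    rfl
  · apply prod_congr rfl
    intro i _
    simp only [succ_mem_up, Fin.val_succ, add_assoc, add_comm 1 par]
    rfl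

lemma hSum_cons (N a : ℕ) (l : List ℕ) (par m : ℕ) :
    hSum N ((a + 1) :: l) par m = ∑ q : Fin (a + 1) → Fin N,
      ((ind (Monotone q) * ind (m < (q 0 : ℕ)) * (∏ j, hw N par (q j)) * hSum N l (par + 1) (q (Fin.last a)))
      + ind (a = 0) * (1 / (N : ℚ)) * ind (Monotone q) * ind ((q 0 : ℕ) = m)
          * hSum N l (par + 1) (q (Fin.last a))) := by
  have e : hSum N ((a + 1) :: l) par m = ∑ A : Finset (Fin l.length), ∑ q : Fin (a + 1) → Fin N, ∑ n : HT N l,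
      ((ind (Monotone q) * ind (m < (q 0 : ℕ)) * (∏ j, hw N par (q j))) *
        (ind (zOne l A) * (1 / (N : ℚ)) ^ A.card * ind (hMono l n) * ind (hLink l A n (q (Fin.last a)))
          * hProd l (par + 1) A n)
       + (ind (a = 0) * (1 / (N : ℚ)) * ind (Monotone q) * ind ((q 0 : ℕ) = m)) *
        (ind (zOne l A) * (1 / (N : ℚ)) ^ A.card * ind (hMono l n) * ind (hLink l A n (q (Fin.last a)))
          * hProd l (par + 1) A n)) := by
    unfold hSum
    refine (sum_up (n := l.length) _).trans ?_
    apply sum_congr rfl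
    intro A _
    rw [← sum_add_distrib]
    refine (sum_consFn (n := l.length)
      (α := fun i : Fin (l.length + 1) => Fin (((a + 1) :: l).get i) → Fin N) _).trans ?_
    apply sum_congr rfl
    intro q _
    apply sum_congr rfl
    intro n _
    rw [hProd_cons (a + 1) l par false A q n, hProd_cons (a + 1) l par true A q n]
    rw [ind_congr (zOne_cons (a + 1) l false A), ind_congr (zOne_cons (a + 1) l true A),
      ind_congr (hMono_cons (a + 1) l q n), ind_congr (hLink_cons a l false A m q n),
      ind_congr (hLink_cons a l true A m q n)]
    have c1 : (up false A).card = A.card := by rw [card_up]; simp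
    have c2 : (up true A).card = A.card + 1 := by rw [card_up]; simp [add_comm]
    have c1' : (up false A : Finset (Fin ((a + 1) :: l).length)).card = A.card := c1
    have c2' : (up true A : Finset (Fin ((a + 1) :: l).length)).card = A.card + 1 := c2
    rw [c1', c2']
    simp only [ind_and, if_true, Bool.false_eq_true, if_false, false_imp_iff, true_imp_iff,
      ind_pos trivial, ne_eq, not_true, not_false_iff, prod_const_one, Nat.add_eq_right, pow_succ]
    ring
  rw [e, sum_comm]
  apply sum_congr rfl
  intro x _
  simp only [sum_add_distrib, ← mul_sum]
  rfl

lemma mono_cons {N a : ℕ} (x : Fin N) (q : Fin (a + 1) → Fin N) :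
    Monotone (Fin.cons x q : Fin (a + 2) → Fin N) ↔ x ≤ q 0 ∧ Monotone q := by
  rw [Fin.monotone_iff_le_succ, Fin.monotone_iff_le_succ]
  constructor
  · intro h
    refine ⟨h 0, fun i => ?_⟩
    have := h i.succ
    rw [← Fin.succ_castSucc] at this
    simpa using this
  · rintro ⟨h1, h2⟩ i
    refine Fin.cases ?_ (fun i => ?_) i
    · exact h1
    · rw [← Fin.succ_castSucc]
      simpa using h2 i

lemma mono_one {N : ℕ} (q : Fin (0 + 1) → Fin N) : Monotone q := by
  intro i j _
  have : i = j := Fin.ext (by omega)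
  rw [this]

lemma chain_sum (N a : ℕ) (g w φ : Fin N → ℚ) :
    ∑ q : Fin (a + 1) → Fin N, ind (Monotone q) * g (q 0) * (∏ j, w (q j)) * φ (q (Fin.last a)) =
      ∑ x, g x * (Matrix.diagonal w *ᵥ ((mW N * Matrix.diagonal w) ^ a *ᵥ φ)) x := by
  induction a generalizing g with
  | zero =>
    refine (sum_consFn (n := 0) (α := fun _ => Fin N) _).trans ?_
    apply sum_congr rfl
    intro x _
    rw [Fintype.sum_unique]
    rw [ind_pos (mono_one _)]
    simp [Matrix.mulVec_diagonal]
    ring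
  | succ a ih =>
    refine (sum_consFn (n := a + 1) (α := fun _ => Fin N) _).trans ?_
    apply sum_congr rfl
    intro x _
    have := ih (fun y => ind (x ≤ y))
    rw [Matrix.mulVec_diagonal, pow_succ', ← Matrix.mulVec_mulVec, ← Matrix.mulVec_mulVec]
    have e2 : (mW N *ᵥ (Matrix.diagonal w *ᵥ ((mW N * Matrix.diagonal w) ^ a *ᵥ φ))) x =
      ∑ y, ind (x ≤ y) * (Matrix.diagonal w *ᵥ ((mW N * Matrix.diagonal w) ^ a *ᵥ φ)) y := by
      rw [Matrix.mulVec, dotProduct]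
      simp only [mW, Matrix.of_apply, ite_ind, mul_one]
    rw [e2, ← this, mul_sum, mul_sum]
    apply sum_congr rfl
    intro q _
    rw [ind_congr (mono_cons x q), ind_and, Fin.prod_univ_succ]
    simp only [Fin.cons_zero, Fin.cons_succ, ← Fin.succ_last]
    ring

noncomputable def hS (N : ℕ) (c : List ℕ) (par : ℕ) : Fin N → ℚ := fun m => hSum N c par m

lemma hS_cons (N a : ℕ) (l : List ℕ) (par : ℕ) :
    hS N ((a + 1) :: l) par = (mU N * Matrix.diagonal (hw N par) * (mW N * Matrix.diagonal (hw N par)) ^ a +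
      (if a + 1 = 1 then (1 / (N : ℚ)) • 1 else 0)) *ᵥ hS N l (par + 1) := by
  funext m
  rw [hS, hSum_cons, sum_add_distrib, Matrix.add_mulVec, Pi.add_apply]
  congr 1
  · have := chain_sum N a (fun y => ind ((m : ℕ) < (y : ℕ))) (hw N par) (hS N l (par + 1))
    refine this.trans ?_
    rw [mul_assoc, ← Matrix.mulVec_mulVec, ← Matrix.mulVec_mulVec]
    generalize (Matrix.diagonal (hw N par) *ᵥ _) = v
    rw [Matrix.mulVec, dotProduct]
    simp only [mU, Matrix.of_apply, ite_ind, mul_one, Fin.lt_def]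
  · rcases a with _ | a
    · refine (sum_consFn (n := 0) (α := fun _ => Fin N) _).trans ?_
      simp only [Fintype.sum_unique]
      rw [sum_eq_single m]
      · rw [ind_pos trivial, ind_pos (mono_one _)]
        simp [Matrix.smul_mulVec, hS, ind]
      · intro x _ hx
        have hx' : ¬ (x : ℕ) = m := fun h => hx (Fin.ext h)
        simp [ind, hx']
      · simp
    · simp [ind]

lemma hSum_par (N : ℕ) (c : List ℕ) (par m : ℕ) : hSum N c (par + 2) m = hSum N c par m := by
  unfold hSum hProd hw
  have : ∀ i : ℕ, (i + (par + 2)) % 2 = (i + par) % 2 := by intro i; omega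
  simp only [this]

lemma hS_nil (N par : ℕ) : hS N [] par = fun _ => 1 := by
  funext m
  simp [hS, hSum, hMono, hLink, hProd, zOne, ind]
  rw [Finset.card_eq_zero.2 (Finset.eq_empty_of_isEmpty _), pow_zero]

lemma hS_cons2 (N a b : ℕ) (ha : 0 < a) (hb : 0 < b) (l : List ℕ) :
    hS N (a :: b :: l) 0 = (mHo N a * mHe N b) *ᵥ hS N l 0 := by
  obtain ⟨a, rfl⟩ : ∃ k, a = k + 1 := ⟨a - 1, by omega⟩
  obtain ⟨b, rfl⟩ : ∃ k, b = k + 1 := ⟨b - 1, by omega⟩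
  rw [hS_cons, hS_cons]
  have e : hS N l (0 + 1 + 1) = hS N l 0 := by
    funext m
    exact hSum_par N l 0 m
  rw [e, Matrix.mulVec_mulVec]
  rfl


/-- extend a set of naturals after shifting by one -/
def upN (x : Bool) (A : Finset ℕ) : Finset ℕ :=
  if x then insert 0 (A.image Nat.succ) else A.image Nat.succ

@[simp] lemma zero_mem_upN (x : Bool) (A : Finset ℕ) : 0 ∈ upN x A ↔ x = true := by
  cases x <;> simp [upN]

@[simp] lemma succ_mem_upN (x : Bool) (A : Finset ℕ) (i : ℕ) : i + 1 ∈ upN x A ↔ i ∈ A := by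
  cases x <;> simp [upN]

lemma card_upN (x : Bool) (A : Finset ℕ) : (upN x A).card = A.card + x.toNat := by
  have h : (A.image Nat.succ).card = A.card := card_image_of_injective _ Nat.succ_injective
  cases x
  · simpa [upN] using h
  · simp only [upN, if_true, Bool.toNat_true]
    rw [card_insert_of_notMem (by simp), h]

lemma sum_upN {V : Type} [AddCommMonoid V] (n : ℕ) (F : Finset ℕ → V) :
    ∑ A ∈ (range (n + 1)).powerset, F A =
      ∑ A ∈ (range n).powerset, (F (upN false A) + F (upN true A)) := by
  have hr : range (n + 1) = insert 0 ((range n).image Nat.succ) := by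
    rw [range_add_one', map_eq_image]; rfl
  rw [hr, sum_powerset_insert (by simp), powerset_image, sum_add_distrib]
  have inj : Set.InjOn (fun A : Finset ℕ => A.image Nat.succ) ((range n).powerset : Set (Finset ℕ)) :=
    fun A _ B _ h => image_injective Nat.succ_injective h
  rw [sum_image inj, sum_image inj]
  rfl

def good (c : List ℕ) (A B : Finset ℕ) : Prop :=
  (∀ i ∈ A, c.getD i 0 = 1) ∧ OddEvenZ A ∧ (∀ i ∈ B, 2 ≤ c.getD i 0) ∧
    (∀ i, i % 2 = 0 → ¬(i ∈ B ∧ i + 1 ∈ B))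

lemma forall_two {P : ℕ → Prop} : (∀ i, P i) ↔ P 0 ∧ P 1 ∧ ∀ i, P (i + 2) := by
  constructor
  · intro h; exact ⟨h 0, h 1, fun i => h _⟩
  · rintro ⟨h0, h1, h2⟩ i
    match i with
    | 0 => exact h0
    | 1 => exact h1
    | i + 2 => exact h2 i

lemma one_mem_upN (x : Bool) (A : Finset ℕ) : 1 ∈ upN x A ↔ 0 ∈ A := succ_mem_upN x A 0

lemma two_mem_upN (x y : Bool) (A : Finset ℕ) (i : ℕ) : i + 2 ∈ upN x (upN y A) ↔ i ∈ A := by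
  rw [show i + 2 = (i + 1) + 1 from rfl, succ_mem_upN, succ_mem_upN]

lemma three_mem_upN (x y : Bool) (A : Finset ℕ) (i : ℕ) : i + 2 + 1 ∈ upN x (upN y A) ↔ i + 1 ∈ A := by
  rw [show i + 2 + 1 = (i + 1) + 2 from rfl, two_mem_upN]

lemma oddEven_up (x y : Bool) (A : Finset ℕ) :
    OddEvenZ (upN x (upN y A)) ↔ (x = y) ∧ OddEvenZ A := by
  unfold OddEvenZ
  rw [forall_two]
  simp only [two_mem_upN, three_mem_upN, zero_mem_upN, one_mem_upN, zero_add, Nat.add_mod_right]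
  have e : ∀ i, (i % 2 = 1 → i + 2 - 1 ∈ upN x (upN y A)) ↔ (i % 2 = 1 → i - 1 ∈ A) := by
    intro i
    refine imp_congr_right fun h => ?_
    have : i + 2 - 1 = (i - 1) + 2 := by omega
    rw [this, two_mem_upN]
  simp only [e]
  rw [← and_assoc]
  apply and_congr_left
  intro _
  cases x <;> cases y <;> simp

lemma good_up (a b : ℕ) (l : List ℕ) (x y u v : Bool) (A B : Finset ℕ) :
    good (a :: b :: l) (upN x (upN y A)) (upN u (upN v B)) ↔
      ((x = true → a = 1) ∧ (y = true → b = 1) ∧ x = y ∧ (u = true → 2 ≤ a) ∧ (v = true → 2 ≤ b)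
        ∧ ¬ (u = true ∧ v = true)) ∧ good l A B := by
  unfold good
  rw [oddEven_up]
  rw [forall_two (P := fun i => i ∈ upN x (upN y A) → _), forall_two (P := fun i => i ∈ upN u (upN v B) → _),
    forall_two (P := fun i => i % 2 = 0 → ¬ (i ∈ upN u (upN v B) ∧ _))]
  simp only [two_mem_upN, three_mem_upN, zero_mem_upN, one_mem_upN, zero_add, Nat.add_mod_right,
    List.getD_cons_zero, List.getD_cons_succ]
  have : ((0 : ℕ) % 2 = 0) = True := by simp
  have : ((1 : ℕ) % 2 = 0) = False := by simp
  simp only [*]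
  tauto

lemma modify_up (a : ℕ) (l : List ℕ) (x u : Bool) (A B : Finset ℕ) :
    modifyIdx (a :: l) (upN x A) (upN u B) =
      (if x = true then [] else [a - u.toNat]) ++ modifyIdx l A B := by
  unfold modifyIdx
  rw [List.length_cons, List.range_succ_eq_map, List.filter_cons, List.filter_map]
  cases x <;> cases u <;> simp [Function.comp_def]

lemma modify_up2 (a b : ℕ) (l : List ℕ) (x u v : Bool) (A B : Finset ℕ) :
    modifyIdx (a :: b :: l) (upN x (upN x A)) (upN u (upN v B)) =
      (if x = true then [] else [a - u.toNat, b - v.toNat]) ++ modifyIdx l A B := by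
  rw [modify_up, modify_up]
  cases x <;> simp

noncomputable def coef (N : ℕ) (c : List ℕ) (A B : Finset ℕ) : ℚ :=
  ind (good c A B) * ((-1 : ℚ) ^ B.card * (1 / (N : ℚ)) ^ (A.card + B.card))

noncomputable def Rv (N : ℕ) (c : List ℕ) : Fin N → ℚ :=
  ∑ A ∈ (range c.length).powerset, ∑ B ∈ (range c.length).powerset,
    coef N c A B • fV N (modifyIdx c A B)

def Fc (N a b : ℕ) : Mat N :=
  mF N a b - (1 / (N : ℚ)) • (if a = 1 then 0 else mF N (a - 1) b)
     - (1 / (N : ℚ)) • (if b = 1 then 0 else mF N a (b - 1))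
     + (if a = 1 ∧ b = 1 then (1 / (N : ℚ)) ^ 2 else 0) • 1

lemma coef_up (N a b : ℕ) (l : List ℕ) (x y u v : Bool) (A B : Finset ℕ) :
    coef N (a :: b :: l) (upN x (upN y A)) (upN u (upN v B)) =
      ind ((x = true → a = 1) ∧ (y = true → b = 1) ∧ x = y ∧ (u = true → 2 ≤ a) ∧ (v = true → 2 ≤ b)
        ∧ ¬ (u = true ∧ v = true)) * ((-1) ^ (u.toNat + v.toNat) *
          (1 / (N : ℚ)) ^ (x.toNat + y.toNat + u.toNat + v.toNat)) * coef N l A B := by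
  unfold coef
  rw [ind_congr (good_up a b l x y u v A B), ind_and]
  simp only [card_upN]
  ring

lemma term_up (N a b : ℕ) (ha : 0 < a) (hb : 0 < b) (l : List ℕ) (A B : Finset ℕ) :
    (∑ x : Bool, ∑ y : Bool, ∑ u : Bool, ∑ v : Bool,
      coef N (a :: b :: l) (upN x (upN y A)) (upN u (upN v B)) •
        fV N (modifyIdx (a :: b :: l) (upN x (upN y A)) (upN u (upN v B)))) =
    coef N l A B • (Fc N a b *ᵥ fV N (modifyIdx l A B)) := by
  have h1 : 2 ≤ a ↔ ¬ a = 1 := by omega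
  have h2 : 2 ≤ b ↔ ¬ b = 1 := by omega
  simp only [coef_up, Fintype.sum_bool, h1, h2]
  simp only [if_true, Bool.false_eq_true, if_false, false_imp_iff, true_imp_iff, true_and, and_true,
    false_and, and_false, not_true, not_false_iff, ind_neg not_false, Bool.toNat_true, Bool.toNat_false,
    modify_up2, zero_mul, zero_smul, zero_add, add_zero, Bool.true_eq_false, ind_pos trivial,
    List.nil_append, List.cons_append, Nat.sub_zero, pow_zero, one_mul]
  rw [fV_cons N a b _ hb]
  unfold Fc
  by_cases ha1 : a = 1 <;> by_cases hb1 : b = 1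
  · subst ha1 hb1
    simp only [ind_pos, ind_neg, not_true, not_false_iff, and_self, and_false, false_and, if_true, Matrix.add_mulVec, Matrix.sub_mulVec,
      Matrix.smul_mulVec, Matrix.one_mulVec, smul_zero, Matrix.zero_mulVec, zero_mul, zero_smul]
    module
  · have hbb : 0 < b - 1 := by omega
    rw [fV_cons N a (b - 1) _ hbb]
    subst ha1
    simp only [hb1, ind_pos, ind_neg, not_true, not_false_iff, and_self, and_false, false_and, if_true, if_false, Matrix.add_mulVec, Matrix.sub_mulVec,
      Matrix.smul_mulVec, Matrix.one_mulVec, smul_zero, Matrix.zero_mulVec, zero_mul, zero_smul]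
    module
  · rw [fV_cons N (a - 1) b _ hb]
    subst hb1
    simp only [ha1, ind_pos, ind_neg, not_true, not_false_iff, and_self, and_false, false_and, if_true, if_false, Matrix.add_mulVec, Matrix.sub_mulVec,
      Matrix.smul_mulVec, Matrix.one_mulVec, smul_zero, Matrix.zero_mulVec, zero_mul, zero_smul]
    module
  · have hbb : 0 < b - 1 := by omega
    rw [fV_cons N (a - 1) b _ hb, fV_cons N a (b - 1) _ hbb]
    simp only [ha1, hb1, ind_pos, ind_neg, not_true, not_false_iff, and_self, and_false, false_and, if_true, if_false, Matrix.add_mulVec, Matrix.sub_mulVec,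
      Matrix.smul_mulVec, Matrix.one_mulVec, smul_zero, Matrix.zero_mulVec, zero_mul, zero_smul]
    module

lemma Rv_cons (N a b : ℕ) (ha : 0 < a) (hb : 0 < b) (l : List ℕ) :
    Rv N (a :: b :: l) = Fc N a b *ᵥ Rv N l := by
  unfold Rv
  simp only [List.length_cons, sum_upN, Matrix.mulVec_sum, Matrix.mulVec_smul, ← sum_add_distrib]
  apply sum_congr rfl
  intro A _
  apply sum_congr rfl
  intro B _
  rw [← term_up N a b ha hb l A B]
  simp only [Fintype.sum_bool]
  abel

lemma FcM (N a b : ℕ) (hN : 0 < N) (ha : 0 < a) (hb : 0 < b) :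
    Fc N a b * mM N = mM N * (mHo N a * mHe N b) := by
  rw [HH N a b hN ha hb, Fc]
  by_cases h1 : a = 1 <;> by_cases h2 : b = 1 <;>
    simp [h1, h2, add_mul, sub_mul, mul_add, mul_sub, FM]

lemma Rv_nil (N : ℕ) : Rv N [] = fun _ => 1 := by
  funext m
  simp [Rv, coef, good, OddEvenZ, modifyIdx, fV_nil, ind]

lemma Rv_eq (N : ℕ) (hN : 0 < N) (s : ℕ) : ∀ c : List ℕ, c.length = 2 * s → (∀ x ∈ c, 0 < x) →
    Rv N c = mM N *ᵥ hS N c 0 := by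
  induction s with
  | zero =>
    intro c hc _
    have : c = [] := List.length_eq_zero_iff.1 (by omega)
    rw [this, Rv_nil, hS_nil, M_one]
  | succ s ih =>
    intro c hc hp
    match c, hc, hp with
    | a :: b :: l, hc, hp =>
      have ha : 0 < a := hp a (by simp)
      have hb : 0 < b := hp b (by simp)
      rw [Rv_cons N a b ha hb, hS_cons2 N a b ha hb,
        ih l (by simp at hc; omega) (fun x hx => hp x (by simp [hx])),
        Matrix.mulVec_mulVec, Matrix.mulVec_mulVec, FcM N a b hN ha hb]

end HF

/-- **Corollary (h in terms of f).**  `h_N(c)` equals the sum over odd-even subsets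
`A` of the `1`-positions of `c` and subsets `B` of the `>1`-positions of `c`
containing no (1-based) pair `{2r-1, 2r}`, of
`(-1)^{#B} · N^{-(#A+#B)} · f_N(c_{(-A)} - δ_B)`. -/
theorem h_eq_sum_f (N s : ℕ) (hNpos : 0 < N) (hs : 0 < s) (c : List ℕ)
    (hlen : c.length = 2 * s) (hpos : ∀ x ∈ c, 0 < x) :
    hN N c =
      ∑ A ∈ (Finset.range c.length).powerset,
        ∑ B ∈ (Finset.range c.length).powerset,
          if (∀ i ∈ A, c.getD i 0 = 1) ∧ OddEvenZ A ∧
              (∀ i ∈ B, 2 ≤ c.getD i 0) ∧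
              (∀ i, i % 2 = 0 → ¬(i ∈ B ∧ i + 1 ∈ B)) then
            (-1 : ℚ) ^ B.card * (1 / (N : ℚ)) ^ (A.card + B.card) *
              fN N (modifyIdx c A B)
          else 0 := by
  have h := congrFun (HF.Rv_eq N hNpos s c hlen hpos) ⟨0, hNpos⟩
  rw [HF.M_zero] at h
  rw [HF.hN_eq]
  refine (h.symm : HF.hSum N c 0 0 = _).trans ?_
  unfold HF.Rv
  simp only [Finset.sum_apply, Pi.smul_apply, smul_eq_mul]
  apply Finset.sum_congr rfl
  intro A _
  apply Finset.sum_congr rfl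
  intro B _
  rw [HF.ite_ind, HF.fN_eq N hNpos, HF.coef, mul_assoc]
  rfl
end
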